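/- arXiv:2501.15221 — 2 statements merged into one kernel-verified Lean document; each statement's English description precedes it below -/
import Mathlib

section
/- Let A ∈ ℝ^{m×n} with rank(A) = m, y ∈ ℝ^m, T ⊆ {1,…,n}, λ > 0. Let (u*, v*) be a global minimizer of g, set z* = u*∘v*, and let γ = Aᵀ(Az* − y). Assume: z* has at most m nonzero entries; T ⊆ supp(z*); and the strict complementarity condition holds, i.e. γ_j = 0 for j ∈ T, γ_j = −λ·sign(z*_j) for j ∈ T^c with z*_j ≠ 0, and |γ_j| < λ for j ∈ T^c with z*_j = 0. Then there exist constants C > 0 and ε > 0 such that ‖∇g(u, v)‖₂ ≥ C·|g(u, v) − g(u*, v*)|^{1/2} for all (u, v) with ‖(u, v) − (u*, v*)‖₂ ≤ ε. -/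
open scoped BigOperators
open Matrix

/-- A vector is `k`-sparse if it has at most `k` nonzero entries. -/
def Sparse {n : ℕ} (k : ℕ) (x : Fin n → ℝ) : Prop :=
  ∃ S : Finset (Fin n), S.card ≤ k ∧ ∀ i ∉ S, x i = 0

/-- The Hadamard product parametrization objective, as a function of the pair `(u, v)`. -/
noncomputable def hppObj {m n : ℕ} (A : Matrix (Fin m) (Fin n) ℝ) (y : Fin m → ℝ)
    (T : Finset (Fin n)) (lam : ℝ) (p : (Fin n → ℝ) × (Fin n → ℝ)) : ℝ :=
  (∑ i, (A.mulVec (fun j => p.1 j * p.2 j) i - y i) ^ 2) / 2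
    + lam / 2 * ((∑ j ∈ Tᶜ, p.1 j ^ 2) + ∑ j ∈ Tᶜ, p.2 j ^ 2)

/-- The ℓ₂ norm of a pair of vectors. -/
noncomputable def pairl2norm {n : ℕ} (p : (Fin n → ℝ) × (Fin n → ℝ)) : ℝ :=
  Real.sqrt ((∑ i, p.1 i ^ 2) + ∑ i, p.2 i ^ 2)

lemma aux_factor {m n : ℕ} (A : Matrix (Fin m) (Fin n) ℝ) (P : Fin n → Prop) :
    ∃ K : ℝ, 0 ≤ K ∧ ∀ (d : Fin n → ℝ) (t : ℝ), 0 ≤ t →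
      (∀ j, P j → |(Aᵀ.mulVec (A.mulVec d)) j| ≤ t) → (∀ j, ¬ P j → |d j| ≤ t) →
      ∀ i, |A.mulVec d i| ≤ K * t := by
  classical
  let L : (Fin n → ℝ) →ₗ[ℝ] (Fin n → ℝ) := LinearMap.pi fun j =>
    if P j then (LinearMap.proj j).comp (Aᵀ.mulVecLin.comp A.mulVecLin) else LinearMap.proj j
  have hL1 : ∀ d j, P j → L d j = (Aᵀ.mulVec (A.mulVec d)) j := by
    intro d j hj; simp only [L, LinearMap.pi_apply, if_pos hj]; rfl
  have hL2 : ∀ d j, ¬ P j → L d j = d j := by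
    intro d j hj; simp [L, hj]
  have hker : LinearMap.ker L ≤ LinearMap.ker A.mulVecLin := by
    intro d hd
    have hd0 : L d = 0 := hd
    have h1 : ∑ j, (Aᵀ.mulVec (A.mulVec d)) j * d j = 0 := by
      apply Finset.sum_eq_zero
      intro j _
      by_cases hj : P j
      · rw [← hL1 d j hj, hd0]; simp
      · have : d j = 0 := by rw [← hL2 d j hj, hd0]; rfl
        rw [this, mul_zero]
    have h2 : (A.mulVec d) ⬝ᵥ (A.mulVec d) = 0 := by
      rw [← h1, Matrix.dotProduct_mulVec, ← Matrix.mulVec_transpose]; rfl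
    have h3 := dotProduct_self_eq_zero.1 h2
    simpa using h3
  obtain ⟨K, hK⟩ : ∃ K : (Fin n → ℝ) →ₗ[ℝ] (Fin m → ℝ), K.comp L = A.mulVecLin := by
    obtain ⟨N, hN⟩ := LinearMap.exists_leftInverse_of_injective
      ((LinearMap.ker L).liftQ L le_rfl) (Submodule.ker_liftQ_eq_bot _ _ _ le_rfl)
    refine ⟨((LinearMap.ker L).liftQ A.mulVecLin hker).comp N, ?_⟩
    ext1 d
    have := LinearMap.congr_fun hN ((LinearMap.ker L).mkQ (Pi.single d 1))
    ext1
    simp at this ⊢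
    rw [this]; simp
  refine ⟨‖LinearMap.toContinuousLinearMap K‖, norm_nonneg _, ?_⟩
  intro d t ht h1 h2 i
  have e : A.mulVec d = (LinearMap.toContinuousLinearMap K) (L d) := by
    have := LinearMap.congr_fun hK d
    simpa using this.symm
  have hLd : ‖L d‖ ≤ t := by
    rw [pi_norm_le_iff_of_nonneg ht]
    intro j
    rw [Real.norm_eq_abs]
    by_cases hj : P j
    · rw [hL1 d j hj]; exact h1 j hj
    · rw [hL2 d j hj]; exact h2 j hj
  calc |A.mulVec d i| = ‖A.mulVec d i‖ := rfl
    _ ≤ ‖A.mulVec d‖ := norm_le_pi_norm _ i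
    _ ≤ ‖LinearMap.toContinuousLinearMap K‖ * ‖L d‖ := by
        rw [e]; exact ContinuousLinearMap.le_opNorm _ _
    _ ≤ _ := by gcongr

lemma aux_quad {m n : ℕ} (A : Matrix (Fin m) (Fin n) ℝ) (y : Fin m → ℝ) (z d : Fin n → ℝ) :
    (∑ i, (A.mulVec (z + d) i - y i) ^ 2) / 2 = (∑ i, (A.mulVec z i - y i) ^ 2) / 2
      + ∑ j, (Aᵀ.mulVec (A.mulVec z - y)) j * d j + (∑ i, (A.mulVec d i) ^ 2) / 2 := by
  have h : ∑ j, (Aᵀ.mulVec (A.mulVec z - y)) j * d j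
      = ∑ i, (A.mulVec z i - y i) * A.mulVec d i := by
    have := Matrix.dotProduct_mulVec (A.mulVec z - y) A d
    rw [← Matrix.mulVec_transpose] at this
    exact this.symm
  rw [h, Finset.sum_div, Finset.sum_div, Finset.sum_div, ← Finset.sum_add_distrib,
    ← Finset.sum_add_distrib]
  refine Finset.sum_congr rfl fun i _ => ?_
  rw [Matrix.mulVec_add, Pi.add_apply]; ring

lemma aux_reg {m n : ℕ} (A : Matrix (Fin m) (Fin n) ℝ) (y : Fin m → ℝ)
    (T : Finset (Fin n)) (lam : ℝ) (p : (Fin n → ℝ) × (Fin n → ℝ)) :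
    hppObj A y T lam p = (∑ i, (A.mulVec (fun j => p.1 j * p.2 j) i - y i) ^ 2) / 2
      + ∑ j, (if j ∈ T then 0 else lam) / 2 * (p.1 j ^ 2 + p.2 j ^ 2) := by
  unfold hppObj
  congr 1
  rw [← Finset.sum_add_distrib, Finset.mul_sum]
  rw [← Finset.sum_subset (Finset.subset_univ Tᶜ)]
  · refine Finset.sum_congr rfl fun j hj => ?_
    rw [if_neg (Finset.mem_compl.1 hj)]
  · intro j _ hj
    rw [Finset.mem_compl, not_not] at hj
    simp [hj]

lemma aux_diff {m n : ℕ} (A : Matrix (Fin m) (Fin n) ℝ) (y : Fin m → ℝ)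
    (T : Finset (Fin n)) (lam : ℝ) : Differentiable ℝ (hppObj A y T lam) := by
  unfold hppObj Matrix.mulVec dotProduct
  fun_prop

lemma aux_dir {E : Type*} [NormedAddCommGroup E] [NormedSpace ℝ E] (f : E → ℝ) (p e : E)
    (hf : DifferentiableAt ℝ f p) (D Q : ℝ)
    (h : ∀ t : ℝ, f (p + t • e) = f p + t * D + t ^ 2 * Q) : fderiv ℝ f p e = D := by
  have h1 : HasDerivAt (fun t : ℝ => f (p + t • e)) (fderiv ℝ f p e) 0 :=
    hf.hasFDerivAt.hasLineDerivAt e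
  have h2 : HasDerivAt (fun t : ℝ => f (p + t • e)) D 0 := by
    simp_rw [h]
    have a := ((hasDerivAt_id (0:ℝ)).mul_const D).const_add (f p)
    have b := ((hasDerivAt_id (0:ℝ)).pow 2).mul_const Q
    have := a.add b
    simpa [Pi.add_def, Pi.pow_def] using this
  exact h1.unique h2

lemma aux_partial1 {m n : ℕ} (A : Matrix (Fin m) (Fin n) ℝ) (y : Fin m → ℝ)
    (T : Finset (Fin n)) (lam : ℝ) (p : (Fin n → ℝ) × (Fin n → ℝ)) (j : Fin n) :
    fderiv ℝ (hppObj A y T lam) p (Pi.single j 1, 0)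
      = (Aᵀ.mulVec (A.mulVec (fun j => p.1 j * p.2 j) - y)) j * p.2 j
        + (if j ∈ T then 0 else lam) * p.1 j := by
  refine aux_dir _ _ _ (aux_diff A y T lam p) _
    ((∑ i, (A.mulVec (Pi.single j (p.2 j)) i) ^ 2) / 2 + (if j ∈ T then 0 else lam) / 2) ?_
  intro t
  rw [aux_reg, aux_reg]
  have e : (fun k => (p + t • ((Pi.single j 1 : Fin n → ℝ), (0 : Fin n → ℝ))).1 k
      * (p + t • ((Pi.single j 1 : Fin n → ℝ), (0 : Fin n → ℝ))).2 k)
      = (fun k => p.1 k * p.2 k) + t • (Pi.single j (p.2 j) : Fin n → ℝ) := by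
    ext k
    by_cases hk : k = j
    · subst hk; simp; ring
    · simp [hk]
  rw [e, aux_quad]
  have e2 : ∑ k, (if k ∈ T then 0 else lam) / 2 *
      ((p + t • ((Pi.single j 1 : Fin n → ℝ), (0 : Fin n → ℝ))).1 k ^ 2
      + (p + t • ((Pi.single j 1 : Fin n → ℝ), (0 : Fin n → ℝ))).2 k ^ 2)
      = ∑ k, (if k ∈ T then 0 else lam) / 2 * (p.1 k ^ 2 + p.2 k ^ 2)
        + (if j ∈ T then 0 else lam) / 2 * (2 * t * p.1 j + t ^ 2) := by
    rw [← sub_eq_iff_eq_add', ← Finset.sum_sub_distrib, Finset.sum_eq_single j]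
    · simp; ring
    · intro k _ hk; simp [hk]
    · simp
  have e3 : ∑ k, (Aᵀ.mulVec (A.mulVec (fun j => p.1 j * p.2 j) - y)) k
      * (t • (Pi.single j (p.2 j) : Fin n → ℝ)) k
      = t * ((Aᵀ.mulVec (A.mulVec (fun j => p.1 j * p.2 j) - y)) j * p.2 j) := by
    rw [Finset.sum_eq_single j]
    · simp; ring
    · intro k _ hk; simp [hk]
    · simp
  have e4 : ∑ i, (A.mulVec (t • (Pi.single j (p.2 j) : Fin n → ℝ)) i) ^ 2
      = t ^ 2 * ∑ i, (A.mulVec (Pi.single j (p.2 j)) i) ^ 2 := by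
    rw [Matrix.mulVec_smul, Finset.mul_sum]
    refine Finset.sum_congr rfl fun i _ => ?_
    rw [Pi.smul_apply, smul_eq_mul, mul_pow]
  rw [e2, e3, e4]
  ring

lemma aux_partial2 {m n : ℕ} (A : Matrix (Fin m) (Fin n) ℝ) (y : Fin m → ℝ)
    (T : Finset (Fin n)) (lam : ℝ) (p : (Fin n → ℝ) × (Fin n → ℝ)) (j : Fin n) :
    fderiv ℝ (hppObj A y T lam) p (0, Pi.single j 1)
      = (Aᵀ.mulVec (A.mulVec (fun j => p.1 j * p.2 j) - y)) j * p.1 j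
        + (if j ∈ T then 0 else lam) * p.2 j := by
  refine aux_dir _ _ _ (aux_diff A y T lam p) _
    ((∑ i, (A.mulVec (Pi.single j (p.1 j)) i) ^ 2) / 2 + (if j ∈ T then 0 else lam) / 2) ?_
  intro t
  rw [aux_reg, aux_reg]
  have e : (fun k => (p + t • ((0 : Fin n → ℝ), (Pi.single j 1 : Fin n → ℝ))).1 k
      * (p + t • ((0 : Fin n → ℝ), (Pi.single j 1 : Fin n → ℝ))).2 k)
      = (fun k => p.1 k * p.2 k) + t • (Pi.single j (p.1 j) : Fin n → ℝ) := by
    ext k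
    by_cases hk : k = j
    · subst hk; simp; ring
    · simp [hk]
  rw [e, aux_quad]
  have e2 : ∑ k, (if k ∈ T then 0 else lam) / 2 *
      ((p + t • ((0 : Fin n → ℝ), (Pi.single j 1 : Fin n → ℝ))).1 k ^ 2
      + (p + t • ((0 : Fin n → ℝ), (Pi.single j 1 : Fin n → ℝ))).2 k ^ 2)
      = ∑ k, (if k ∈ T then 0 else lam) / 2 * (p.1 k ^ 2 + p.2 k ^ 2)
        + (if j ∈ T then 0 else lam) / 2 * (2 * t * p.2 j + t ^ 2) := by
    rw [← sub_eq_iff_eq_add', ← Finset.sum_sub_distrib, Finset.sum_eq_single j]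
    · simp; ring
    · intro k _ hk; simp [hk]
    · simp
  have e3 : ∑ k, (Aᵀ.mulVec (A.mulVec (fun j => p.1 j * p.2 j) - y)) k
      * (t • (Pi.single j (p.1 j) : Fin n → ℝ)) k
      = t * ((Aᵀ.mulVec (A.mulVec (fun j => p.1 j * p.2 j) - y)) j * p.1 j) := by
    rw [Finset.sum_eq_single j]
    · simp; ring
    · intro k _ hk; simp [hk]
    · simp
  have e4 : ∑ i, (A.mulVec (t • (Pi.single j (p.1 j) : Fin n → ℝ)) i) ^ 2
      = t ^ 2 * ∑ i, (A.mulVec (Pi.single j (p.1 j)) i) ^ 2 := by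
    rw [Matrix.mulVec_smul, Finset.mul_sum]
    refine Finset.sum_congr rfl fun i _ => ?_
    rw [Pi.smul_apply, smul_eq_mul, mul_pow]
  rw [e2, e3, e4]
  ring

/-- Coordinate in `T`. -/
lemma aux_caseT (a b w G a0 b0 : ℝ) (hb0 : b0 ≠ 0) (hb : |b0| / 2 < |b|)
    (h1 : |w * b| ≤ G) : |w| ≤ 2 / |b0| * G := by
  have h0 : 0 < |b0| := abs_pos.2 hb0
  rw [abs_mul] at h1
  rw [div_mul_eq_mul_div, le_div_iff₀ h0]
  nlinarith [abs_nonneg w]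

/-- Coordinate in the support, outside `T`. -/
lemma aux_caseS (a b w G b0 s lam : ℝ) (hlam : 0 < lam) (hb0 : b0 ≠ 0) (hs : s ^ 2 = 1)
    (hb : |b| < 2 * |b0|) (hab : |b0| < |b + s * a|)
    (h1 : |(w - lam * s) * b + lam * a| ≤ G) (h2 : |(w - lam * s) * a + lam * b| ≤ G) :
    |w| ≤ 2 / |b0| * G ∧ |lam / 2 * (a - s * b) ^ 2| ≤ 25 / (2 * lam) * G ^ 2 := by
  have h0 : 0 < |b0| := abs_pos.2 hb0
  have hs1 : |s| = 1 := by
    have : |s| ^ 2 = 1 := by rw [sq_abs, hs]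
    nlinarith [abs_nonneg s]
  have hG : 0 ≤ G := (abs_nonneg _).trans h1
  have h3 : |w| * |b + s * a| ≤ 2 * G := by
    rw [← abs_mul]
    have e : w * (b + s * a) = ((w - lam * s) * b + lam * a)
        + s * ((w - lam * s) * a + lam * b) := by linear_combination lam * a * hs
    rw [e]
    refine (abs_add_le _ _).trans ?_
    rw [abs_mul s, hs1]; linarith
  have hw : |w| * |b0| ≤ 2 * G := by nlinarith [abs_nonneg w]
  have h4 : lam * |a - s * b| ≤ 5 * G := by
    have e : lam * |a - s * b| = |((w - lam * s) * b + lam * a) - w * b| := by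
      rw [← abs_of_pos hlam, ← abs_mul, abs_of_pos hlam]; congr 1; ring
    rw [e]
    refine (abs_sub _ _).trans ?_
    rw [abs_mul w]
    nlinarith [abs_nonneg w]
  refine ⟨by rw [div_mul_eq_mul_div, le_div_iff₀ h0]; exact hw, ?_⟩
  rw [abs_of_nonneg (by positivity), div_mul_eq_mul_div 25, le_div_iff₀ (by positivity)]
  have h5 : (lam * |a - s * b|) ^ 2 ≤ (5 * G) ^ 2 := by gcongr
  rw [mul_pow, sq_abs] at h5
  nlinarith

/-- Coordinate off the support. -/
lemma aux_caseN (a b w G lam g κ : ℝ) (hlam : 0 < lam) (hκ : κ < lam) (hg : |g| < lam)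
    (hw : |w + g| < κ) (hb : |b| < 1)
    (h1 : |(w + g) * b + lam * a| ≤ G) (h2 : |(w + g) * a + lam * b| ≤ G) :
    |a * b| ≤ 2 / (lam - κ) * G ∧
      |lam / 2 * (a ^ 2 + b ^ 2) + g * (a * b)| ≤ 2 * lam * (2 / (lam - κ)) ^ 2 * G ^ 2 := by
  have hG : 0 ≤ G := (abs_nonneg _).trans h1
  have key : ∀ a b : ℝ, |(w + g) * b + lam * a| ≤ G → lam * |a| ≤ G + κ * |b| := by
    intro a b h
    have e : lam * |a| = |((w + g) * b + lam * a) - (w + g) * b| := by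
      rw [← abs_of_pos hlam, ← abs_mul, abs_of_pos hlam]; congr 1; ring
    rw [e]
    refine (abs_sub _ _).trans ?_
    rw [abs_mul (w + g)]
    nlinarith [abs_nonneg b]
  have k1 := key a b h1
  have k2 := key b a h2
  have hp : 0 < lam - κ := by linarith
  have hsum : |a| + |b| ≤ 2 / (lam - κ) * G := by
    rw [div_mul_eq_mul_div, le_div_iff₀ hp]; nlinarith
  have ha := abs_nonneg a
  have hb' := abs_nonneg b
  refine ⟨by rw [abs_mul]; nlinarith, ?_⟩
  set c := 2 / (lam - κ) * G
  have e : 2 * lam * (2 / (lam - κ)) ^ 2 * G ^ 2 = 2 * lam * c ^ 2 := by simp only [c]; ring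
  rw [e]
  refine (abs_add_le _ _).trans ?_
  rw [abs_of_nonneg (by positivity), abs_mul, abs_mul, ← sq_abs a, ← sq_abs b]
  have : |g| * (|a| * |b|) ≤ lam * (|a| * |b|) := by gcongr
  have h6 : (|a| + |b|) ^ 2 ≤ c ^ 2 := by gcongr
  have h7 : 0 ≤ |a| * |b| := by positivity
  nlinarith [mul_le_mul_of_nonneg_left h6 hlam.le, mul_nonneg hlam.le h7,
    mul_nonneg hlam.le (sq_nonneg |a|), mul_nonneg hlam.le (sq_nonneg |b|)]

open Filter Topology in
lemma aux_coord {α : Type*} (l : Filter α) (a b w G : α → ℝ) (a0 b0 lam g mu : ℝ)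
    (hlam : 0 < lam)
    (ha : Tendsto a l (𝓝 a0)) (hb : Tendsto b l (𝓝 b0)) (hw : Tendsto w l (𝓝 0))
    (h1 : ∀ x, |(w x + g) * b x + mu * a x| ≤ G x)
    (h2 : ∀ x, |(w x + g) * a x + mu * b x| ≤ G x)
    (hcase : (mu = 0 ∧ g = 0 ∧ a0 * b0 ≠ 0) ∨
      (mu = lam ∧ a0 * b0 ≠ 0 ∧ ∃ s : ℝ, s ^ 2 = 1 ∧ g = -lam * s ∧ a0 = s * b0) ∨
      (mu = lam ∧ a0 = 0 ∧ b0 = 0 ∧ |g| < lam)) :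
    ∃ C : ℝ, 0 ≤ C ∧ ∀ᶠ x in l,
      |mu / 2 * (a x ^ 2 + b x ^ 2) - mu / 2 * (a0 ^ 2 + b0 ^ 2) + g * (a x * b x - a0 * b0)|
        ≤ C * G x ^ 2 ∧ (a0 * b0 ≠ 0 → |w x| ≤ C * G x) ∧
      (¬ a0 * b0 ≠ 0 → |a x * b x - a0 * b0| ≤ C * G x) := by
  have hG : ∀ x, 0 ≤ G x := fun x => (abs_nonneg _).trans (h1 x)
  rcases hcase with ⟨rfl, rfl, hz⟩ | ⟨rfl, hz, s, hs, rfl, rfl⟩ | ⟨rfl, rfl, rfl, hg⟩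
  · have hb0 : b0 ≠ 0 := right_ne_zero_of_mul hz
    refine ⟨2 / |b0|, by positivity, ?_⟩
    have hp : |b0| / 2 < |b0| := half_lt_self (abs_pos.2 hb0)
    filter_upwards [hb.abs.eventually (lt_mem_nhds hp)] with x hx
    refine ⟨?_, fun _ => ?_, fun h => absurd hz h⟩
    · simp; positivity
    · have := h1 x
      simp only [add_zero, zero_mul] at this
      exact aux_caseT (a x) _ _ _ a0 _ hb0 hx this
  · have hb0 : b0 ≠ 0 := right_ne_zero_of_mul hz
    have hp : 0 < |b0| := abs_pos.2 hb0
    have t1 : Tendsto (fun x => |b x + s * a x|) l (𝓝 |b0 + s * (s * b0)|) :=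
      (hb.add (ha.const_mul s)).abs
    have e1 : |b0 + s * (s * b0)| = 2 * |b0| := by
      have : b0 + s * (s * b0) = 2 * b0 := by linear_combination b0 * hs
      rw [this, abs_mul, abs_two]
    rw [e1] at t1
    refine ⟨2 / |b0| + 25 / (2 * mu), by positivity, ?_⟩
    filter_upwards [t1.eventually (lt_mem_nhds (by linarith : |b0| < 2 * |b0|)),
      hb.abs.eventually (gt_mem_nhds (by linarith : |b0| < 2 * |b0|))] with x hx1 hx2
    have k1 := h1 x
    have k2 := h2 x
    have e : w x + -mu * s = w x - mu * s := by ring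
    rw [e] at k1 k2
    obtain ⟨r1, r2⟩ := aux_caseS (a x) (b x) (w x) (G x) b0 s mu hlam hb0 hs hx2 hx1 k1 k2
    refine ⟨?_, fun _ => ?_, fun h => absurd hz h⟩
    · have e : mu / 2 * (a x ^ 2 + b x ^ 2) - mu / 2 * ((s * b0) ^ 2 + b0 ^ 2)
          + -mu * s * (a x * b x - s * b0 * b0) = mu / 2 * (a x - s * b x) ^ 2 := by
        linear_combination (-mu / 2 * (b x) ^ 2 + mu / 2 * b0 ^ 2) * hs
      rw [e]
      refine r2.trans ?_
      gcongr
      exact le_add_of_nonneg_left (by positivity)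
    · refine r1.trans ?_
      have := hG x
      gcongr
      exact le_add_of_nonneg_right (by positivity)
  · have hp : 0 < mu - (mu + |g|) / 2 := by linarith
    refine ⟨2 / (mu - (mu + |g|) / 2) + 2 * mu * (2 / (mu - (mu + |g|) / 2)) ^ 2,
      by positivity, ?_⟩
    have t1 : Tendsto (fun x => |w x + g|) l (𝓝 |0 + g|) := (hw.add_const g).abs
    rw [zero_add] at t1
    filter_upwards [t1.eventually (gt_mem_nhds (by linarith : |g| < (mu + |g|) / 2)),
      hb.abs.eventually (gt_mem_nhds (by simp : |(0:ℝ)| < 1))] with x hx1 hx2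
    obtain ⟨r1, r2⟩ := aux_caseN (a x) (b x) (w x) (G x) mu g ((mu + |g|) / 2) hlam
      (by linarith) hg hx1 hx2 (h1 x) (h2 x)
    refine ⟨?_, fun h => absurd (by simp) h, fun _ => ?_⟩
    · have e : mu / 2 * (a x ^ 2 + b x ^ 2) - mu / 2 * ((0:ℝ) ^ 2 + 0 ^ 2)
          + g * (a x * b x - 0 * 0) = mu / 2 * (a x ^ 2 + b x ^ 2) + g * (a x * b x) := by ring
      rw [e]
      refine r2.trans ?_
      gcongr
      exact le_add_of_nonneg_left (by positivity)
    · have e : a x * b x - 0 * 0 = a x * b x := by ring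
      rw [e]
      refine r1.trans ?_
      have := hG x
      gcongr
      exact le_add_of_nonneg_right (by positivity)

theorem stmt15 {m n : ℕ} (A : Matrix (Fin m) (Fin n) ℝ) (hrank : A.rank = m)
    (y : Fin m → ℝ) (T : Finset (Fin n)) (lam : ℝ) (hlam : 0 < lam)
    (ustar vstar : Fin n → ℝ)
    -- `(u*, v*)` is a global minimizer of `g`
    (hopt : ∀ p : (Fin n → ℝ) × (Fin n → ℝ),
      hppObj A y T lam (ustar, vstar) ≤ hppObj A y T lam p)
    (zstar : Fin n → ℝ) (hz : zstar = fun j => ustar j * vstar j)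
    (γ : Fin n → ℝ) (hγ : γ = Aᵀ.mulVec (A.mulVec zstar - y))
    -- `z*` has at most `m` nonzero entries
    (hsp : Sparse m zstar)
    -- `T ⊆ supp(z*)`
    (hTsupp : ∀ j ∈ T, zstar j ≠ 0)
    -- strict complementarity
    (hsc1 : ∀ j ∈ T, γ j = 0)
    (hsc2 : ∀ j ∈ Tᶜ, zstar j ≠ 0 → γ j = -lam * Real.sign (zstar j))
    (hsc3 : ∀ j ∈ Tᶜ, zstar j = 0 → |γ j| < lam) :
    ∃ C > 0, ∃ ε > 0, ∀ p : (Fin n → ℝ) × (Fin n → ℝ),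
      pairl2norm (p.1 - ustar, p.2 - vstar) ≤ ε →
      C * Real.sqrt |hppObj A y T lam p - hppObj A y T lam (ustar, vstar)|
        ≤ ‖fderiv ℝ (hppObj A y T lam) p‖ := by
  classical
  subst hz
  set zs : Fin n → ℝ := fun j => ustar j * vstar j with hzs
  set μ : Fin n → ℝ := fun j => if j ∈ T then 0 else lam with hμ
  set g := hppObj A y T lam with hg
  let W : (Fin n → ℝ) × (Fin n → ℝ) → Fin n → ℝ :=
    fun p => Aᵀ.mulVec (A.mulVec ((fun j => p.1 j * p.2 j) - zs))
  have hW : ∀ p j, (Aᵀ.mulVec (A.mulVec (fun j => p.1 j * p.2 j) - y)) j = W p j + γ j := by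
    intro p j
    simp only [W, hγ]
    rw [← Pi.add_apply, ← Matrix.mulVec_add, Matrix.mulVec_sub A]
    congr 2; abel
  have hs1 : ‖(1:ℝ)‖ ≤ 1 := by simp
  have hP1 : ∀ p j, |(W p j + γ j) * p.2 j + μ j * p.1 j| ≤ ‖fderiv ℝ g p‖ := by
    intro p j
    rw [← hW, ← aux_partial1 A y T lam p j]
    refine ((fderiv ℝ g p).le_opNorm _).trans ?_
    rw [Prod.norm_mk, Pi.norm_single]; simp
  have hP2 : ∀ p j, |(W p j + γ j) * p.1 j + μ j * p.2 j| ≤ ‖fderiv ℝ g p‖ := by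
    intro p j
    rw [← hW, ← aux_partial2 A y T lam p j]
    refine ((fderiv ℝ g p).le_opNorm _).trans ?_
    rw [Prod.norm_mk, Pi.norm_single]; simp
  have hW0 : ∀ j, W (ustar, vstar) j = 0 := by
    intro j
    have : (fun j => (ustar, vstar).1 j * (ustar, vstar).2 j) - zs = 0 := by
      rw [hzs]; exact sub_self _
    simp only [W, this, Matrix.mulVec_zero, Pi.zero_apply]
  have hcrit : fderiv ℝ g (ustar, vstar) = 0 :=
    IsLocalMin.fderiv_eq_zero (Filter.Eventually.of_forall hopt)
  have hc1 : ∀ j, γ j * vstar j + μ j * ustar j = 0 := by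
    intro j
    have := hP1 (ustar, vstar) j
    rw [hcrit, norm_zero, hW0, zero_add] at this
    exact abs_nonpos_iff.1 this
  have hc2 : ∀ j, γ j * ustar j + μ j * vstar j = 0 := by
    intro j
    have := hP2 (ustar, vstar) j
    rw [hcrit, norm_zero, hW0, zero_add] at this
    exact abs_nonpos_iff.1 this
  have hWc : Continuous W := by
    simp only [W]
    fun_prop
  have hcoord : ∀ j, ∃ C : ℝ, 0 ≤ C ∧ ∀ᶠ p : (Fin n → ℝ) × (Fin n → ℝ) in nhds (ustar, vstar),
      |μ j / 2 * (p.1 j ^ 2 + p.2 j ^ 2) - μ j / 2 * (ustar j ^ 2 + vstar j ^ 2)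
        + γ j * (p.1 j * p.2 j - ustar j * vstar j)| ≤ C * ‖fderiv ℝ g p‖ ^ 2 ∧
      (ustar j * vstar j ≠ 0 → |W p j| ≤ C * ‖fderiv ℝ g p‖) ∧
      (¬ ustar j * vstar j ≠ 0 → |p.1 j * p.2 j - ustar j * vstar j| ≤ C * ‖fderiv ℝ g p‖) := by
    intro j
    refine aux_coord (nhds (ustar, vstar)) (fun p => p.1 j) (fun p => p.2 j) (fun p => W p j)
      (fun p => ‖fderiv ℝ g p‖) (ustar j) (vstar j) lam (γ j) (μ j) hlam ?_ ?_ ?_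
      (fun p => hP1 p j) (fun p => hP2 p j) ?_
    · exact Continuous.tendsto (by fun_prop) (ustar, vstar)
    · exact Continuous.tendsto (by fun_prop) (ustar, vstar)
    · have := (((continuous_apply j).comp hWc).tendsto (ustar, vstar))
      simp only [Function.comp_apply, hW0] at this
      exact this
    · by_cases hT : j ∈ T
      · left
        exact ⟨by simp [hμ, hT], hsc1 j hT, hTsupp j hT⟩
      · have hm : μ j = lam := by simp [hμ, hT]
        have hTc : j ∈ Tᶜ := Finset.mem_compl.2 hT
        have c1 := hc1 j
        have c2 := hc2 j
        rw [hm] at c1 c2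
        by_cases hz : zs j = 0
        · right; right
          have hl := hsc3 j hTc hz
          have hl2 := abs_lt.1 hl
          have hne : 0 < lam ^ 2 - γ j ^ 2 := by nlinarith
          refine ⟨hm, ?_, ?_, hl⟩
          · have : (lam ^ 2 - γ j ^ 2) * ustar j = 0 := by
              linear_combination lam * c1 - γ j * c2
            exact (mul_eq_zero.1 this).resolve_left hne.ne'
          · have : (lam ^ 2 - γ j ^ 2) * vstar j = 0 := by
              linear_combination lam * c2 - γ j * c1
            exact (mul_eq_zero.1 this).resolve_left hne.ne'
        · right; left
          have hgj := hsc2 j hTc hz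
          refine ⟨hm, hz, Real.sign (zs j), ?_, hgj, ?_⟩
          · rcases Real.sign_apply_eq_of_ne_zero _ hz with h | h <;> rw [h] <;> norm_num
          · rw [hgj] at c1
            have : lam * (ustar j - Real.sign (zs j) * vstar j) = 0 := by linear_combination c1
            exact sub_eq_zero.1 ((mul_eq_zero.1 this).resolve_left hlam.ne')
  choose C hC0 hC using hcoord
  obtain ⟨K, hK0, hK⟩ := aux_factor A (fun j => ustar j * vstar j ≠ 0)
  have hall := Filter.eventually_all.2 hC
  obtain ⟨δ, hδ, hball⟩ := Metric.eventually_nhds_iff.1 hall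
  set M := ∑ j, C j with hM
  have hM0 : 0 ≤ M := Finset.sum_nonneg fun j _ => hC0 j
  have hCM : ∀ j, C j ≤ M := fun j =>
    Finset.single_le_sum (fun k _ => hC0 k) (Finset.mem_univ j)
  set B := (m * (K * M) ^ 2) / 2 + M + 1 with hB
  have hBpos : 0 < B := by positivity
  refine ⟨1 / Real.sqrt B, by positivity, δ / 2, by positivity, ?_⟩
  intro p hp
  have hdist : dist p (ustar, vstar) < δ := by
    refine lt_of_le_of_lt ?_ (half_lt_self hδ)
    have hb := (Real.sqrt_le_left (by positivity)).1 hp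
    simp only [Pi.sub_apply] at hb
    have n1 : 0 ≤ ∑ i, (p.1 i - ustar i) ^ 2 := Finset.sum_nonneg fun i _ => sq_nonneg _
    have n2 : 0 ≤ ∑ i, (p.2 i - vstar i) ^ 2 := Finset.sum_nonneg fun i _ => sq_nonneg _
    rw [Prod.dist_eq]
    refine max_le ?_ ?_
    · refine (dist_pi_le_iff (by positivity)).2 fun i => ?_
      rw [Real.dist_eq]
      refine abs_le_of_sq_le_sq ?_ (by positivity)
      have := Finset.single_le_sum (f := fun i => (p.1 i - ustar i) ^ 2)
        (fun k _ => sq_nonneg _) (Finset.mem_univ i)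
      linarith
    · refine (dist_pi_le_iff (by positivity)).2 fun i => ?_
      rw [Real.dist_eq]
      refine abs_le_of_sq_le_sq ?_ (by positivity)
      have := Finset.single_le_sum (f := fun i => (p.2 i - vstar i) ^ 2)
        (fun k _ => sq_nonneg _) (Finset.mem_univ i)
      linarith
  have hq := hball hdist
  set G := ‖fderiv ℝ g p‖ with hG
  have hG0 : 0 ≤ G := norm_nonneg _
  have hAd := hK ((fun j => p.1 j * p.2 j) - zs) (M * G) (by positivity)
    (fun j hj => ((hq j).2.1 hj).trans (by gcongr; exact hCM j))
    (fun j hj => ((hq j).2.2 hj).trans (by gcongr; exact hCM j))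
  have hexp : g p - g (ustar, vstar)
      = (∑ i, (A.mulVec ((fun j => p.1 j * p.2 j) - zs) i) ^ 2) / 2
        + ∑ j, (μ j / 2 * (p.1 j ^ 2 + p.2 j ^ 2) - μ j / 2 * (ustar j ^ 2 + vstar j ^ 2)
        + γ j * (p.1 j * p.2 j - ustar j * vstar j)) := by
    rw [hg, aux_reg, aux_reg]
    have h := aux_quad A y zs ((fun j => p.1 j * p.2 j) - zs)
    rw [add_sub_cancel, ← hγ] at h
    rw [h, Finset.sum_add_distrib, Finset.sum_sub_distrib]
    simp only [Pi.sub_apply, hzs, hμ]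
    ring
  have hbound : |g p - g (ustar, vstar)| ≤ B * G ^ 2 := by
    rw [hexp]
    refine (abs_add_le _ _).trans ?_
    have b1 : |(∑ i, (A.mulVec ((fun j => p.1 j * p.2 j) - zs) i) ^ 2) / 2|
        ≤ (m * (K * (M * G)) ^ 2) / 2 := by
      rw [abs_of_nonneg (by positivity)]
      gcongr
      calc _ ≤ ∑ i : Fin m, (K * (M * G)) ^ 2 := by
            refine Finset.sum_le_sum fun i _ => ?_
            rw [← sq_abs]
            gcongr
            exact hAd i
        _ = _ := by simp
    have b2 := (Finset.abs_sum_le_sum_abs (fun j => (μ j / 2 * (p.1 j ^ 2 + p.2 j ^ 2)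
        - μ j / 2 * (ustar j ^ 2 + vstar j ^ 2)
        + γ j * (p.1 j * p.2 j - ustar j * vstar j))) Finset.univ).trans
        (Finset.sum_le_sum fun j _ => (hq j).1)
    rw [← Finset.sum_mul] at b2
    have : 0 ≤ G ^ 2 := sq_nonneg _
    rw [hB]
    nlinarith
  rw [one_div, inv_mul_le_iff₀ (by positivity)]
  refine (Real.sqrt_le_sqrt hbound).trans ?_
  rw [Real.sqrt_mul hBpos.le, Real.sqrt_sq hG0]
end

section
/- Let A ∈ ℝ^{m×n} with rank(A) = m, y ∈ ℝ^m, T ⊆ {1,…,n} with |T| ≤ m, and λ > 0. For α > 0, consider the set N_α of initial points (u₀, v₀) ∈ ℝⁿ×ℝⁿ such that α > sup{ max(‖∇²_u g(u,v)‖, ‖∇²_v g(u,v)‖) : g(u,v) ≤ g(u₀,v₀) } and the proximal alternating minimization sequence started at (u₀, v₀) converges to a critical point of g that is not a global minimizer of g. Then N_α has Lebesgue measure zero; that is, for almost every admissible initialization the limit of the algorithm is a global minimizer of g. -/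
open scoped BigOperators
open Matrix

/-- Operator norm of the partial Hessian of `g` with respect to `u`, at `(u, v)`. -/
noncomputable def hessuNorm {m n : ℕ} (A : Matrix (Fin m) (Fin n) ℝ) (y : Fin m → ℝ)
    (T : Finset (Fin n)) (lam : ℝ) (q : (Fin n → ℝ) × (Fin n → ℝ)) : ℝ :=
  ‖fderiv ℝ (fun u => fderiv ℝ (fun u' => hppObj A y T lam (u', q.2)) u) q.1‖

/-- Operator norm of the partial Hessian of `g` with respect to `v`, at `(u, v)`. -/
noncomputable def hessvNorm {m n : ℕ} (A : Matrix (Fin m) (Fin n) ℝ) (y : Fin m → ℝ)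
    (T : Finset (Fin n)) (lam : ℝ) (q : (Fin n → ℝ) × (Fin n → ℝ)) : ℝ :=
  ‖fderiv ℝ (fun v => fderiv ℝ (fun v' => hppObj A y T lam (q.1, v')) v) q.2‖



structure QN {E : Type*} [NormedAddCommGroup E] [NormedSpace ℝ E] (f : E → ℝ) : Prop where
  cont : Continuous f
  hom : ∀ (t : ℝ) (a : E), f (t • a) = t ^ 2 * f a
  nonneg : ∀ a, 0 ≤ f a
  weak : ∀ (t : ℝ), 0 < t → ∀ a b, f (a + b) ≤ (1 + t) * f a + (1 + 1 / t) * f b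

section QNsec
variable {E : Type*} [NormedAddCommGroup E] [NormedSpace ℝ E]

theorem QN.add {f g : E → ℝ} (hf : QN f) (hg : QN g) : QN (fun a => f a + g a) where
  cont := hf.cont.add hg.cont
  hom t a := by rw [hf.hom, hg.hom]; ring
  nonneg a := add_nonneg (hf.nonneg a) (hg.nonneg a)
  weak t ht a b := by
    have := hf.weak t ht a b
    have := hg.weak t ht a b
    linarith

theorem QN.smul {f : E → ℝ} (hf : QN f) {c : ℝ} (hc : 0 ≤ c) : QN (fun a => c * f a) where
  cont := hf.cont.const_mul c
  hom t a := by rw [hf.hom]; ring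
  nonneg a := mul_nonneg hc (hf.nonneg a)
  weak t ht a b := by
    have := mul_le_mul_of_nonneg_left (hf.weak t ht a b) hc
    linarith

theorem QN.zero : QN (fun _ : E => (0 : ℝ)) where
  cont := continuous_const
  hom t a := by simp
  nonneg a := le_rfl
  weak t ht a b := by simp

theorem QN.sum {ι : Type*} (s : Finset ι) {f : ι → E → ℝ} (hf : ∀ i ∈ s, QN (f i)) :
    QN (fun a => ∑ i ∈ s, f i a) where
  cont := continuous_finsetSum s fun i hi => (hf i hi).cont
  hom t a := by
    rw [Finset.mul_sum]; exact Finset.sum_congr rfl fun i hi => (hf i hi).hom t a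
  nonneg a := Finset.sum_nonneg fun i hi => (hf i hi).nonneg a
  weak t ht a b := by
    rw [Finset.mul_sum, Finset.mul_sum, ← Finset.sum_add_distrib]
    exact Finset.sum_le_sum fun i hi => (hf i hi).weak t ht a b

theorem weak_sq {t : ℝ} (ht : 0 < t) (x y : ℝ) :
    (x + y) ^ 2 ≤ (1 + t) * x ^ 2 + (1 + 1 / t) * y ^ 2 := by
  have h : (1 + t) * x ^ 2 + (1 + 1 / t) * y ^ 2 - (x + y) ^ 2 = (t * x - y) ^ 2 / t := by
    field_simp; ring
  have : 0 ≤ (t * x - y) ^ 2 / t := by positivity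
  linarith

theorem QN.sq {φ : E → ℝ} (hc : Continuous φ) (ha : ∀ a b, φ (a + b) = φ a + φ b)
    (hs : ∀ (t : ℝ) a, φ (t • a) = t * φ a) : QN (fun a => φ a ^ 2) where
  cont := hc.pow 2
  hom t a := by rw [hs]; ring
  nonneg a := sq_nonneg _
  weak t ht a b := by rw [ha]; exact weak_sq ht _ _

theorem QN.upper [FiniteDimensional ℝ E] {f : E → ℝ} (hf : QN f) :
    ∃ K : ℝ, 0 < K ∧ ∀ a, f a ≤ K * ‖a‖ ^ 2 := by
  have : ProperSpace E := FiniteDimensional.proper ℝ E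
  obtain ⟨K, hK⟩ := (isCompact_sphere (0 : E) 1).bddAbove_image hf.cont.continuousOn
  refine ⟨max K 1, by positivity, fun a => ?_⟩
  by_cases h : a = 0
  · subst h
    have := hf.hom 0 0
    simp at this
    simp [this]
  have hn : ‖a‖ ≠ 0 := norm_ne_zero_iff.2 h
  have h1 : f (‖a‖⁻¹ • a) ≤ K := hK ⟨_, by simp [norm_smul, hn], rfl⟩
  have h2 : f a = ‖a‖ ^ 2 * f (‖a‖⁻¹ • a) := by
    rw [hf.hom]; field_simp
  rw [h2, mul_comm]
  exact mul_le_mul_of_nonneg_right (h1.trans (le_max_left _ _)) (by positivity)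

theorem QN.lower [FiniteDimensional ℝ E] {f : E → ℝ} (hf : QN f) (h0 : ∀ a, f a = 0 → a = 0) :
    ∃ C : ℝ, 0 < C ∧ ∀ a, ‖a‖ ^ 2 ≤ C * f a := by
  have : ProperSpace E := FiniteDimensional.proper ℝ E
  have hpos : ∀ a ∈ Metric.sphere (0 : E) 1, 0 < f a := by
    intro a ha
    refine lt_of_le_of_ne (hf.nonneg a) fun h => ?_
    have := h0 a h.symm
    subst this
    simp at ha
  obtain ⟨K, hK⟩ := (isCompact_sphere (0 : E) 1).bddAbove_image
    (f := fun a => (f a)⁻¹) (hf.cont.continuousOn.inv₀ fun a ha => (hpos a ha).ne')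
  refine ⟨max K 1, by positivity, fun a => ?_⟩
  by_cases h : a = 0
  · subst h
    have := hf.nonneg 0
    simp
    positivity
  have hn : ‖a‖ ≠ 0 := norm_ne_zero_iff.2 h
  have hm : ‖a‖⁻¹ • a ∈ Metric.sphere (0 : E) 1 := by simp [norm_smul, hn]
  have h1 : (f (‖a‖⁻¹ • a))⁻¹ ≤ K := hK ⟨_, hm, rfl⟩
  have h3 := hpos _ hm
  have h2 : f a = ‖a‖ ^ 2 * f (‖a‖⁻¹ • a) := by
    rw [hf.hom]; field_simp
  have h4 : 1 ≤ max K 1 * f (‖a‖⁻¹ • a) := by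
    have := mul_le_mul_of_nonneg_right (h1.trans (le_max_left K 1)) h3.le
    rwa [inv_mul_cancel₀ h3.ne'] at this
  rw [h2]
  have := mul_le_mul_of_nonneg_left h4 (sq_nonneg ‖a‖)
  linarith

/-- one-step cone arithmetic -/
theorem cone_arith {τ ρ η P0 N0 P1 N1 : ℝ} (hτ0 : 0 ≤ τ) (hρ : 1 ≤ ρ) (hη : 0 < η)
    (h1 : ρ * (τ + 2 * η) + 2 * η < 1) (hP1 : 0 ≤ P1) (hN1 : 0 ≤ N1)
    (hc : N0 ≤ P0) (hP : P0 ≤ τ * P1 + η * (P1 + N1)) (hN : N1 ≤ ρ * N0 + η * (P1 + N1)) :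
    N1 ≤ P1 ∧ P0 ≤ (τ + 2 * η) * P1 := by
  have key : N1 ≤ P1 := by
    by_contra hlt
    push Not at hlt
    have a1 : P0 ≤ (τ + 2 * η) * N1 := by nlinarith
    have a2 : N1 ≤ ρ * ((τ + 2 * η) * N1) + 2 * η * N1 := by
      have : ρ * N0 ≤ ρ * ((τ + 2 * η) * N1) :=
        mul_le_mul_of_nonneg_left (hc.trans a1) (by linarith)
      nlinarith
    have : 0 < N1 := lt_of_le_of_lt hP1 hlt
    nlinarith
  exact ⟨key, by nlinarith⟩

theorem cone_lemma [FiniteDimensional ℝ E] {G : E → E} {D : E →L[ℝ] E} {x : E}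
    (hG : HasStrictFDerivAt G D x) {p n : E → ℝ} (hp : QN p) (hn : QN n)
    (h0 : ∀ a, p a + n a = 0 → a = 0) {τ ρ : ℝ} (hτ0 : 0 ≤ τ) (hρ : 1 ≤ ρ) (hτρ : τ * ρ < 1)
    (hpD : ∀ a, p (D a) ≤ τ * p a) (hnD : ∀ a, n a ≤ ρ * n (D a)) :
    ∃ U : Set E, IsOpen U ∧ x ∈ U ∧ ∀ s r : ℕ → E, (∀ k, s k ∈ U) → (∀ k, r k ∈ U) →
      (∀ k, G (s (k+1)) = s k) → (∀ k, G (r (k+1)) = r k) →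
      n (s 0 - r 0) ≤ p (s 0 - r 0) → s 0 = r 0 := by
  obtain ⟨Kp, hKp, hp'⟩ := hp.upper
  obtain ⟨Kn, hKn, hn'⟩ := hn.upper
  obtain ⟨C, hC, hlow⟩ := (hp.add hn).lower h0
  -- choose t
  obtain ⟨t, ht, ht1⟩ : ∃ t : ℝ, 0 < t ∧ ρ * (1 + t) * ((1 + t) * τ) < 1 := by
    have hcont : Continuous fun t : ℝ => ρ * (1 + t) * ((1 + t) * τ) := by fun_prop
    have : ∀ᶠ t in nhds (0:ℝ), ρ * (1 + t) * ((1 + t) * τ) < 1 :=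
      hcont.continuousAt.eventually_lt continuousAt_const (by simp; linarith)
    obtain ⟨e, he, hb⟩ := Metric.eventually_nhds_iff.1 this
    exact ⟨e/2, by positivity, hb (by simp [abs_of_pos he, he])⟩
  obtain ⟨η, hη, hη1⟩ : ∃ η : ℝ, 0 < η ∧
      ρ * (1 + t) * ((1 + t) * τ + 2 * η) + 2 * η < 1 := by
    have hcont : Continuous fun η : ℝ => ρ * (1 + t) * ((1 + t) * τ + 2 * η) + 2 * η := by fun_prop
    have : ∀ᶠ η in nhds (0:ℝ), ρ * (1 + t) * ((1 + t) * τ + 2 * η) + 2 * η < 1 :=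
      hcont.continuousAt.eventually_lt continuousAt_const (by simpa using ht1)
    obtain ⟨e, he, hb⟩ := Metric.eventually_nhds_iff.1 this
    exact ⟨e/2, by positivity, hb (by simp [abs_of_pos he, he])⟩
  -- choose ε
  obtain ⟨ε, hε, hε1, hε2⟩ : ∃ ε : ℝ, 0 < ε ∧ (1 + 1 / t) * Kp * C * ε ^ 2 ≤ η ∧
      ρ * (1 + 1 / t) * Kn * C * ε ^ 2 ≤ η := by
    set M := (1 + 1 / t) * Kp * C + ρ * (1 + 1 / t) * Kn * C with hM
    have m1 : 0 < (1 + 1 / t) * Kp * C := by positivity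
    have m2 : 0 < ρ * (1 + 1 / t) * Kn * C := by
      have : 0 < ρ := by linarith
      positivity
    have m : 0 < M := by linarith
    refine ⟨Real.sqrt (η / M), Real.sqrt_pos.2 (by positivity), ?_, ?_⟩
    · rw [Real.sq_sqrt (by positivity), mul_div_assoc', div_le_iff₀ m]
      nlinarith
    · rw [Real.sq_sqrt (by positivity), mul_div_assoc', div_le_iff₀ m]
      nlinarith
  obtain ⟨W, hW, hA⟩ := hG.approximates_deriv_on_nhds (c := ⟨ε, hε.le⟩) (Or.inr hε)
  refine ⟨interior W ∩ Metric.ball x 1, isOpen_interior.inter Metric.isOpen_ball,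
    ⟨mem_interior_iff_mem_nhds.2 hW, Metric.mem_ball_self one_pos⟩, ?_⟩
  intro s r hs hr hGs hGr hc
  have hρt : 1 ≤ ρ * (1 + t) := by nlinarith
  have step : ∀ k, n (s k - r k) ≤ p (s k - r k) →
      n (s (k+1) - r (k+1)) ≤ p (s (k+1) - r (k+1)) ∧
      p (s k - r k) ≤ ((1 + t) * τ + 2 * η) * p (s (k+1) - r (k+1)) := by
    intro k hk
    set d1 := s (k+1) - r (k+1) with hd1
    have he : ‖(s k - r k) - D d1‖ ≤ ε * ‖d1‖ := by
      have := hA _ (interior_subset (hs (k+1)).1) _ (interior_subset (hr (k+1)).1)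
      rw [hGs, hGr] at this
      exact this
    set e := (s k - r k) - D d1 with hedef
    have he2 : ‖e‖ ^ 2 ≤ ε ^ 2 * (C * (p d1 + n d1)) := by
      calc ‖e‖ ^ 2 ≤ (ε * ‖d1‖) ^ 2 := by gcongr
        _ = ε ^ 2 * ‖d1‖ ^ 2 := by ring
        _ ≤ _ := by gcongr; exact hlow d1
    have hpn : 0 ≤ p d1 + n d1 := add_nonneg (hp.nonneg _) (hn.nonneg _)
    have htt : 0 < 1 + 1 / t := by positivity
    refine cone_arith (by positivity) hρt hη hη1 (hp.nonneg _) (hn.nonneg _) hk ?_ ?_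
    · have e1 : s k - r k = D d1 + e := by simp [hedef]
      have b1 := hp.weak t ht (D d1) e
      rw [← e1] at b1
      have b2 : (1 + t) * p (D d1) ≤ (1 + t) * (τ * p d1) := by gcongr; exact hpD d1
      have b3 : (1 + 1 / t) * p e ≤ (1 + 1 / t) * (Kp * (ε ^ 2 * (C * (p d1 + n d1)))) := by
        gcongr
        exact (hp' e).trans (by gcongr)
      have b4 := mul_le_mul_of_nonneg_right hε1 hpn
      nlinarith
    · have e1 : D d1 = (s k - r k) + (-1 : ℝ) • e := by simp [hedef]
      have b1 := hn.weak t ht (s k - r k) ((-1 : ℝ) • e)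
      rw [← e1, hn.hom] at b1
      have b2 := hnD d1
      have b5 := mul_le_mul_of_nonneg_left b1 (by linarith : (0:ℝ) ≤ ρ)
      have hρ0 : 0 ≤ ρ := by linarith
      have b3 : ρ * (1 + 1 / t) * n e ≤
          ρ * (1 + 1 / t) * (Kn * (ε ^ 2 * (C * (p d1 + n d1)))) := by
        gcongr
        exact (hn' e).trans (by gcongr)
      have b4 := mul_le_mul_of_nonneg_right hε2 hpn
      nlinarith
  set θ := (1 + t) * τ + 2 * η with hθ
  have hθ0 : 0 ≤ θ := by positivity
  have hθ1 : θ < 1 := by nlinarith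
  have hall : ∀ k, n (s k - r k) ≤ p (s k - r k) ∧ p (s 0 - r 0) ≤ θ ^ k * p (s k - r k) := by
    intro k
    induction k with
    | zero => exact ⟨hc, by simp⟩
    | succ k ih =>
      obtain ⟨a1, a2⟩ := step k ih.1
      refine ⟨a1, ih.2.trans ?_⟩
      rw [pow_succ, mul_assoc]
      gcongr
  have hb : ∀ k, p (s 0 - r 0) ≤ θ ^ k * (Kp * 2 ^ 2) := by
    intro k
    refine (hall k).2.trans ?_
    gcongr
    refine (hp' _).trans ?_
    gcongr
    have h1 := (hs k).2
    have h2 := (hr k).2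
    rw [Metric.mem_ball] at h1 h2
    rw [← dist_eq_norm]
    have := dist_triangle_right (s k) (r k) x
    linarith
  have hlim : Filter.Tendsto (fun k => θ ^ k * (Kp * 2 ^ 2)) Filter.atTop (nhds 0) := by
    simpa using (tendsto_pow_atTop_nhds_zero_of_lt_one hθ0 hθ1).mul_const (Kp * 2 ^ 2)
  have hle : p (s 0 - r 0) ≤ 0 := ge_of_tendsto' hlim hb
  have : s 0 - r 0 = 0 := h0 _ (by
    have := hp.nonneg (s 0 - r 0)
    have := hn.nonneg (s 0 - r 0)
    linarith)
  exact sub_eq_zero.1 this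

/-- a set whose points differ only by vectors outside the cone is null -/
theorem null_of_cone [FiniteDimensional ℝ E] [MeasurableSpace E] [BorelSpace E]
    (μ : MeasureTheory.Measure E) [μ.IsAddHaarMeasure] {p n : E → ℝ} (hp : QN p) (hn : QN n)
    {w : E} (hw : n w < p w) {S : Set E}
    (hS : ∀ a ∈ S, ∀ b ∈ S, n (a - b) ≤ p (a - b) → a = b) : μ S = 0 := by
  have hcl : ∀ a ∈ closure S, ∀ b ∈ closure S, p (a - b) ≤ n (a - b) := by
    have h0 : ∀ a ∈ S, ∀ b ∈ S, p (a - b) ≤ n (a - b) := by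
      intro a ha b hb
      by_contra h
      push Not at h
      have := hS a ha b hb h.le
      subst this
      have h1 := hp.hom 0 (a - a)
      have h2 := hn.hom 0 (a - a)
      simp at h1 h2
      simp [h1, h2] at h
    have hcl : IsClosed {q : E × E | p (q.1 - q.2) ≤ n (q.1 - q.2)} :=
      isClosed_le (hp.cont.comp (continuous_fst.sub continuous_snd))
        (hn.cont.comp (continuous_fst.sub continuous_snd))
    have hsub : closure (S ×ˢ S) ⊆ {q : E × E | p (q.1 - q.2) ≤ n (q.1 - q.2)} :=
      closure_minimal (fun q hq => h0 _ hq.1 _ hq.2) hcl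
    intro a ha b hb
    have : (a, b) ∈ closure (S ×ˢ S) := by rw [closure_prod_eq]; exact ⟨ha, hb⟩
    exact hsub this
  refine MeasureTheory.measure_mono_null subset_closure ?_
  have : ProperSpace E := FiniteDimensional.proper ℝ E
  have hae := MeasureTheory.ae_mem_of_ae_add_linearMap_mem (𝕜 := ℝ)
    (LinearMap.toSpanSingleton ℝ E w) MeasureTheory.volume μ (s := (closure S)ᶜ)
    isClosed_closure.measurableSet.compl (by
      intro y
      have : {t : ℝ | ¬ (y + LinearMap.toSpanSingleton ℝ E w t ∈ (closure S)ᶜ)}.Subsingleton := by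
        intro t ht t' ht'
        simp only [Set.mem_compl_iff, not_not, Set.mem_ofPred_eq,
          LinearMap.toSpanSingleton_apply] at ht ht'
        have h := hcl _ ht _ ht'
        have e : y + t • w - (y + t' • w) = (t - t') • w := by rw [sub_smul]; abel
        rw [e, hp.hom, hn.hom] at h
        by_contra hne
        have : 0 < (t - t') ^ 2 := by
          have := sub_ne_zero.2 hne
          positivity
        nlinarith
      exact this.measure_zero _)
  rw [MeasureTheory.ae_iff] at hae
  simpa using hae

theorem null_cover [FiniteDimensional ℝ E] [MeasurableSpace E] [BorelSpace E]
    (μ : MeasureTheory.Measure E) [μ.IsAddHaarMeasure] {G : E → E} (hG : Differentiable ℝ G)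
    {B : Set E} (hB : ∀ x ∈ B, ∃ U : Set E, IsOpen U ∧ x ∈ U ∧
      μ {a | ∃ s : ℕ → E, s 0 = a ∧ (∀ k, s k ∈ U) ∧ ∀ k, G (s (k+1)) = s k} = 0) :
    μ {a | ∃ s : ℕ → E, s 0 = a ∧ (∀ k, G (s (k+1)) = s k) ∧
      ∃ x ∈ B, Filter.Tendsto s Filter.atTop (nhds x)} = 0 := by
  choose! U hUo hxU hU0 using hB
  obtain ⟨t, htB, htc, hcov⟩ := TopologicalSpace.countable_cover_nhdsWithin (f := U) (s := B)
    (fun x hx => mem_nhdsWithin_of_mem_nhds ((hUo x hx).mem_nhds (hxU x hx)))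
  have hsub : {a | ∃ s : ℕ → E, s 0 = a ∧ (∀ k, G (s (k+1)) = s k) ∧
      ∃ x ∈ B, Filter.Tendsto s Filter.atTop (nhds x)} ⊆
      ⋃ x ∈ t, ⋃ K : ℕ, G^[K] '' {a | ∃ s : ℕ → E, s 0 = a ∧ (∀ k, s k ∈ U x) ∧
        ∀ k, G (s (k+1)) = s k} := by
    rintro a ⟨s, rfl, hGs, x, hx, hlim⟩
    obtain ⟨y, hy, hxy⟩ := Set.mem_iUnion₂.1 (hcov hx)
    obtain ⟨K, hK⟩ := Filter.eventually_atTop.1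
      (hlim.eventually ((hUo y (htB hy)).mem_nhds hxy))
    refine Set.mem_iUnion₂.2 ⟨y, hy, Set.mem_iUnion.2 ⟨K, s K, ⟨fun k => s (K + k), rfl,
      fun k => hK _ (by omega), fun k => hGs (K + k)⟩, ?_⟩⟩
    clear hK
    induction K with
    | zero => rfl
    | succ K ih => rw [Function.iterate_succ_apply, hGs, ih]
  refine MeasureTheory.measure_mono_null hsub ?_
  refine (MeasureTheory.measure_biUnion_null_iff htc).2 fun x hx => ?_
  refine MeasureTheory.measure_iUnion_null fun K => ?_
  exact MeasureTheory.addHaar_image_eq_zero_of_differentiableOn_of_addHaar_eq_zero μ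
    (hG.iterate K).differentiableOn (hU0 x (htB hx))

end QNsec

section Concrete
variable {m n : ℕ}

noncomputable def zzF (A : Matrix (Fin m) (Fin n) ℝ) (y : Fin m → ℝ) (u v : Fin n → ℝ)
    (j : Fin n) : ℝ :=
  ∑ i, A i j * ((∑ k, A i k * (u k * v k)) - y i)

noncomputable def gAF (A : Matrix (Fin m) (Fin n) ℝ) (y : Fin m → ℝ) (l : Fin n → ℝ)
    (u v : Fin n → ℝ) (j : Fin n) : ℝ :=
  v j * zzF A y u v j + l j * u j

noncomputable def zdF (A : Matrix (Fin m) (Fin n) ℝ) (u v du dv : Fin n → ℝ) (j : Fin n) : ℝ :=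
  ∑ i, A i j * ∑ k, A i k * (du k * v k + u k * dv k)

noncomputable def PhiF (A : Matrix (Fin m) (Fin n) ℝ) (y : Fin m → ℝ) (l : Fin n → ℝ) (α : ℝ)
    (p : (Fin n → ℝ) × (Fin n → ℝ)) : (Fin n → ℝ) × (Fin n → ℝ) :=
  (fun j => p.1 j + α * gAF A y l p.1 p.2 j, p.2)

noncomputable def PsiF (A : Matrix (Fin m) (Fin n) ℝ) (y : Fin m → ℝ) (l : Fin n → ℝ) (α : ℝ)
    (p : (Fin n → ℝ) × (Fin n → ℝ)) : (Fin n → ℝ) × (Fin n → ℝ) :=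
  (p.1, fun j => p.2 j + α * gAF A y l p.2 p.1 j)

theorem zzF_comm (A : Matrix (Fin m) (Fin n) ℝ) (y : Fin m → ℝ) (u v : Fin n → ℝ) (j : Fin n) :
    zzF A y u v j = zzF A y v u j := by
  simp only [zzF, mul_comm (u _) (v _)]

theorem zdF_comm (A : Matrix (Fin m) (Fin n) ℝ) (u v du dv : Fin n → ℝ) (j : Fin n) :
    zdF A u v du dv j = zdF A v u dv du j := by
  unfold zdF
  refine Finset.sum_congr rfl fun i _ => ?_
  congr 1
  exact Finset.sum_congr rfl fun k _ => by ring

theorem PhiF_contDiff (A : Matrix (Fin m) (Fin n) ℝ) (y : Fin m → ℝ) (l : Fin n → ℝ) (α : ℝ) :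
    ContDiff ℝ 1 (PhiF A y l α) := by
  unfold PhiF gAF zzF
  fun_prop

theorem PsiF_contDiff (A : Matrix (Fin m) (Fin n) ℝ) (y : Fin m → ℝ) (l : Fin n → ℝ) (α : ℝ) :
    ContDiff ℝ 1 (PsiF A y l α) := by
  unfold PsiF gAF zzF
  fun_prop

theorem gAF_deriv (A : Matrix (Fin m) (Fin n) ℝ) (y : Fin m → ℝ) (l : Fin n → ℝ)
    (u v du dv : Fin n → ℝ) (j : Fin n) :
    HasDerivAt (fun t : ℝ => gAF A y l (u + t • du) (v + t • dv) j)
      (dv j * zzF A y u v j + v j * zdF A u v du dv j + l j * du j) 0 := by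
  have hu : ∀ k, HasDerivAt (fun t : ℝ => (u + t • du) k) (du k) 0 := by
    intro k
    simpa using ((hasDerivAt_id (0:ℝ)).mul_const (du k)).const_add (u k)
  have hv : ∀ k, HasDerivAt (fun t : ℝ => (v + t • dv) k) (dv k) 0 := by
    intro k
    simpa using ((hasDerivAt_id (0:ℝ)).mul_const (dv k)).const_add (v k)
  have hz : HasDerivAt (fun t : ℝ => zzF A y (u + t • du) (v + t • dv) j)
      (zdF A u v du dv j) 0 := by
    unfold zzF zdF
    refine HasDerivAt.fun_sum fun i _ => HasDerivAt.const_mul _ ?_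
    refine HasDerivAt.sub_const _ (HasDerivAt.fun_sum fun k _ => HasDerivAt.const_mul _ ?_)
    simpa using (hu k).fun_mul (hv k)
  have := ((hv j).fun_mul hz).fun_add ((hu j).const_mul (l j))
  simpa [gAF] using this

theorem PhiF_fderiv (A : Matrix (Fin m) (Fin n) ℝ) (y : Fin m → ℝ) (l : Fin n → ℝ) (α : ℝ)
    (p d : (Fin n → ℝ) × (Fin n → ℝ)) :
    fderiv ℝ (PhiF A y l α) p d = (fun j => d.1 j + α * (d.2 j * zzF A y p.1 p.2 j
      + p.2 j * zdF A p.1 p.2 d.1 d.2 j + l j * d.1 j), d.2) := by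
  have hd : DifferentiableAt ℝ (PhiF A y l α) p :=
    (PhiF_contDiff A y l α).differentiable (by norm_num) p
  have h1 := hd.hasFDerivAt.hasLineDerivAt d
  unfold HasLineDerivAt at h1
  refine h1.unique ?_
  refine HasDerivAt.prodMk ?_ ?_
  · rw [hasDerivAt_pi]
    intro j
    refine HasDerivAt.add ?_ (HasDerivAt.const_mul _ (gAF_deriv A y l p.1 p.2 d.1 d.2 j))
    simpa using ((hasDerivAt_id (0:ℝ)).mul_const (d.1 j)).const_add (p.1 j)
  · simpa using ((hasDerivAt_id (0:ℝ)).smul_const (d.2)).const_add (p.2)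

theorem PsiF_fderiv (A : Matrix (Fin m) (Fin n) ℝ) (y : Fin m → ℝ) (l : Fin n → ℝ) (α : ℝ)
    (p d : (Fin n → ℝ) × (Fin n → ℝ)) :
    fderiv ℝ (PsiF A y l α) p d = (d.1, fun j => d.2 j + α * (d.1 j * zzF A y p.2 p.1 j
      + p.1 j * zdF A p.2 p.1 d.2 d.1 j + l j * d.2 j)) := by
  have hd : DifferentiableAt ℝ (PsiF A y l α) p :=
    (PsiF_contDiff A y l α).differentiable (by norm_num) p
  have h1 := hd.hasFDerivAt.hasLineDerivAt d
  unfold HasLineDerivAt at h1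
  refine h1.unique ?_
  refine HasDerivAt.prodMk ?_ ?_
  · simpa using ((hasDerivAt_id (0:ℝ)).smul_const (d.1)).const_add (p.1)
  · rw [hasDerivAt_pi]
    intro j
    refine HasDerivAt.add ?_ (HasDerivAt.const_mul _ (gAF_deriv A y l p.2 p.1 d.2 d.1 j))
    simpa using ((hasDerivAt_id (0:ℝ)).mul_const (d.2 j)).const_add (p.2 j)

/-- quadratic form on the good coordinates -/
noncomputable def QfF (A : Matrix (Fin m) (Fin n) ℝ) (S : Finset (Fin n)) (u v z l : Fin n → ℝ)
    (du dv : Fin n → ℝ) : ℝ :=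
  ∑ i, (∑ k, A i k * (du k * v k + u k * dv k)) ^ 2
    + ∑ j ∈ S, (2 * z j * du j * dv j + l j * (du j ^ 2 + dv j ^ 2))

theorem QfF_comm (A : Matrix (Fin m) (Fin n) ℝ) (S : Finset (Fin n)) (u v z l : Fin n → ℝ)
    (du dv : Fin n → ℝ) : QfF A S u v z l du dv = QfF A S v u z l dv du := by
  unfold QfF
  congr 1
  · refine Finset.sum_congr rfl fun i _ => ?_
    congr 1
    exact Finset.sum_congr rfl fun k _ => by ring
  · exact Finset.sum_congr rfl fun k _ => by ring

theorem QfF_step (A : Matrix (Fin m) (Fin n) ℝ) (S : Finset (Fin n)) (u v z l : Fin n → ℝ)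
    {α : ℝ} (hα : 0 < α) (hl : ∀ j ∈ S, 0 ≤ l j) (hv : ∀ j ∉ S, v j = 0)
    (du du1 dv : Fin n → ℝ)
    (h : ∀ j ∈ S, du j = du1 j + α * (dv j * z j + v j * zdF A u v du1 dv j + l j * du1 j)) :
    QfF A S u v z l du1 dv + 2 / α * ∑ j ∈ S, (du1 j - du j) ^ 2 ≤ QfF A S u v z l du dv := by
  set X : Fin m → ℝ := fun i => ∑ k, A i k * (du1 k * v k + u k * dv k) with hX
  set Y : Fin m → ℝ := fun i => ∑ k, A i k * ((du k - du1 k) * v k) with hY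
  have hXY : ∀ i, ∑ k, A i k * (du k * v k + u k * dv k) = X i + Y i := by
    intro i
    simp only [hX, hY, ← Finset.sum_add_distrib]
    exact Finset.sum_congr rfl fun k _ => by ring
  have hcross : ∑ i, X i * Y i = ∑ j ∈ S, (du j - du1 j) * (v j * zdF A u v du1 dv j) := by
    have e1 : ∑ i, X i * Y i = ∑ j, (du j - du1 j) * (v j * zdF A u v du1 dv j) := by
      simp only [hY, zdF, Finset.mul_sum]
      rw [Finset.sum_comm]
      refine Finset.sum_congr rfl fun j _ => Finset.sum_congr rfl fun i _ => ?_
      simp only [← Finset.mul_sum]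
      simp only [hX]
      ring
    rw [e1]
    symm
    refine Finset.sum_subset (Finset.subset_univ S) fun j _ hj => ?_
    rw [hv j hj]; ring
  have hQ : QfF A S u v z l du dv = QfF A S u v z l du1 dv + 2 * ∑ i, X i * Y i + ∑ i, Y i ^ 2
      + ∑ j ∈ S, (2 * z j * (du j - du1 j) * dv j
          + l j * (2 * du1 j * (du j - du1 j) + (du j - du1 j) ^ 2)) := by
    have e1 : ∑ i, (X i + Y i) ^ 2 = ∑ i, X i ^ 2 + 2 * ∑ i, X i * Y i + ∑ i, Y i ^ 2 := by
      rw [Finset.mul_sum, ← Finset.sum_add_distrib, ← Finset.sum_add_distrib]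
      exact Finset.sum_congr rfl fun i _ => by ring
    have e2 : ∑ j ∈ S, (2 * z j * du j * dv j + l j * (du j ^ 2 + dv j ^ 2)) =
        ∑ j ∈ S, (2 * z j * du1 j * dv j + l j * (du1 j ^ 2 + dv j ^ 2)) +
        ∑ j ∈ S, (2 * z j * (du j - du1 j) * dv j
          + l j * (2 * du1 j * (du j - du1 j) + (du j - du1 j) ^ 2)) := by
      rw [← Finset.sum_add_distrib]
      exact Finset.sum_congr rfl fun i _ => by ring
    unfold QfF
    simp only [hXY]
    rw [e1, e2]
    ring
  have hY0 : 0 ≤ ∑ i, Y i ^ 2 := Finset.sum_nonneg fun i _ => sq_nonneg _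
  have hfin : 2 / α * ∑ j ∈ S, (du1 j - du j) ^ 2 ≤
      2 * ∑ j ∈ S, (du j - du1 j) * (v j * zdF A u v du1 dv j)
      + ∑ j ∈ S, (2 * z j * (du j - du1 j) * dv j
          + l j * (2 * du1 j * (du j - du1 j) + (du j - du1 j) ^ 2)) := by
    rw [Finset.mul_sum, Finset.mul_sum, ← Finset.sum_add_distrib]
    refine Finset.sum_le_sum fun j hj => ?_
    have hh := h j hj
    have : v j * zdF A u v du1 dv j = (du j - du1 j) / α - dv j * z j - l j * du1 j := by
      field_simp; linarith
    rw [this]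
    have h2 := mul_nonneg (hl j hj) (sq_nonneg (du j - du1 j))
    have h3 : 2 / α * (du1 j - du j) ^ 2 = 2 * ((du j - du1 j) * ((du j - du1 j) / α)) := by
      field_simp; ring
    rw [h3]
    nlinarith
  rw [hQ, hcross]
  linarith

theorem root_lemma_pos {a κ : ℝ} (hκ : 1 ≤ κ) (ha : 0 < a) (h : κ - 1 < a) :
    ∃ x x' : ℝ, x ≠ x' ∧ κ * x ^ 2 = a * x + 1 ∧ κ * x' ^ 2 = a * x' + 1 ∧
      κ ^ 2 * x ^ 2 < 1 ∧ 1 ≤ κ ^ 2 * x' ^ 2 := by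
  have hs := Real.sq_sqrt (show 0 ≤ a ^ 2 + 4 * κ by positivity)
  set s := Real.sqrt (a ^ 2 + 4 * κ) with hsdef
  have hs0 : 0 ≤ s := Real.sqrt_nonneg _
  have hκ0 : 0 < κ := by linarith
  have s1 : s < a + 2 := by nlinarith
  have s2 : 2 ≤ s := by nlinarith
  have s3 : a < s := by nlinarith
  refine ⟨(a - s) / (2 * κ), (a + s) / (2 * κ), ?_, ?_, ?_, ?_, ?_⟩
  · intro h
    have := div_left_inj' (by positivity : 2 * κ ≠ 0) |>.1 h
    linarith
  · field_simp; nlinarith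
  · field_simp; nlinarith
  · have : κ ^ 2 * ((a - s) / (2 * κ)) ^ 2 = ((s - a) / 2) ^ 2 := by field_simp; ring
    rw [this]; nlinarith
  · have : κ ^ 2 * ((a + s) / (2 * κ)) ^ 2 = ((s + a) / 2) ^ 2 := by field_simp; ring
    rw [this]; nlinarith

theorem root_lemma {a κ : ℝ} (hκ : 1 ≤ κ) (h : κ - 1 < |a|) :
    ∃ x x' : ℝ, x ≠ x' ∧ κ * x ^ 2 = a * x + 1 ∧ κ * x' ^ 2 = a * x' + 1 ∧
      κ ^ 2 * x ^ 2 < 1 ∧ 1 ≤ κ ^ 2 * x' ^ 2 := by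
  rcases lt_trichotomy a 0 with ha | ha | ha
  · rw [abs_of_neg ha] at h
    obtain ⟨x, x', h1, h2, h3, h4, h5⟩ := root_lemma_pos hκ (neg_pos.2 ha) h
    exact ⟨-x, -x', by simpa using h1, by linear_combination h2, by linear_combination h3,
      by simpa using h4, by simpa using h5⟩
  · subst ha; simp at h; linarith
  · rw [abs_of_pos ha] at h
    exact root_lemma_pos hκ ha h

/-- eigen-functional computation -/
theorem eig_lemma {a κ x du1 dv1 dv du : ℝ} (hx : κ * x ^ 2 = a * x + 1)
    (hdv : dv = κ * dv1 + a * du1) (hdu : du = κ * du1 + a * dv) :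
    x * du + dv = κ ^ 2 * x ^ 2 * (x * du1 + dv1) := by
  subst hdu; subst hdv
  linear_combination (-(x * κ * du1 + κ * dv1 + a * du1)) * hx
end Concrete

section Loc
variable {m n : ℕ}

theorem QfF_QN (A : Matrix (Fin m) (Fin n) ℝ) (S : Finset (Fin n)) (u v z l : Fin n → ℝ)
    (hz : ∀ j ∈ S, |z j| ≤ l j) :
    QN (fun d : (Fin n → ℝ) × (Fin n → ℝ) => QfF A S u v z l d.1 d.2) := by
  unfold QfF
  refine QN.add (QN.sum _ fun i _ => QN.sq (by fun_prop) ?_ ?_) (QN.sum _ fun j hj => ?_)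
  · intro a b
    rw [← Finset.sum_add_distrib]
    exact Finset.sum_congr rfl fun k _ => by simp; ring
  · intro t a
    rw [Finset.mul_sum]
    exact Finset.sum_congr rfl fun k _ => by simp; ring
  · have h := abs_le.1 (hz j hj)
    have q1 : QN (fun d : (Fin n → ℝ) × (Fin n → ℝ) => (d.1 j + d.2 j) ^ 2) :=
      QN.sq (by fun_prop) (fun a b => by simp; ring) (fun t a => by simp; ring)
    have q2 : QN (fun d : (Fin n → ℝ) × (Fin n → ℝ) => (d.1 j - d.2 j) ^ 2) :=
      QN.sq (by fun_prop) (fun a b => by simp; ring) (fun t a => by simp; ring)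
    have := (q1.smul (c := (l j + z j) / 2) (by linarith)).add
      (q2.smul (c := (l j - z j) / 2) (by linarith))
    convert this using 2
    ring

theorem exists_tau (B : Finset (Fin n)) (f : Fin n → ℝ) (h0 : ∀ j ∈ B, 0 ≤ f j)
    (h : ∀ j ∈ B, f j < 1) : ∃ τ : ℝ, 0 ≤ τ ∧ τ < 1 ∧ ∀ j ∈ B, f j ≤ τ := by
  rcases B.eq_empty_or_nonempty with rfl | hB
  · exact ⟨0, le_rfl, one_pos, by simp⟩
  · obtain ⟨j, hj, hm⟩ := B.exists_max_image f hB
    exact ⟨f j, h0 j hj, h j hj, hm⟩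

theorem local_null (A : Matrix (Fin m) (Fin n) ℝ) (y : Fin m → ℝ) (l : Fin n → ℝ)
    (hl : ∀ j, 0 ≤ l j) {α : ℝ} (hα : 0 < α) (P : (Fin n → ℝ) × (Fin n → ℝ))
    (hgu : ∀ j, gAF A y l P.1 P.2 j = 0) (hgv : ∀ j, gAF A y l P.2 P.1 j = 0)
    (hbad : ∃ j, l j < |zzF A y P.1 P.2 j|) :
    ∃ U : Set ((Fin n → ℝ) × (Fin n → ℝ)), IsOpen U ∧ P ∈ U ∧
      MeasureTheory.volume {a | ∃ s : ℕ → (Fin n → ℝ) × (Fin n → ℝ), s 0 = a ∧ (∀ k, s k ∈ U) ∧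
        ∀ k, PhiF A y l α (PsiF A y l α (s (k+1))) = s k} = 0 := by
  obtain ⟨u, v⟩ := P
  dsimp only at hgu hgv hbad
  set z : Fin n → ℝ := zzF A y u v with hz
  have hz' : ∀ j, zzF A y v u j = z j := fun j => zzF_comm A y v u j
  classical
  set B : Finset (Fin n) := Finset.univ.filter fun j => l j < |z j| with hB
  have hBm : ∀ j, j ∈ B ↔ l j < |z j| := fun j => by simp [hB]
  have hSm : ∀ j, j ∈ Bᶜ ↔ |z j| ≤ l j := fun j => by simp [hB]
  have hzero : ∀ j ∈ B, u j = 0 ∧ v j = 0 := by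
    intro j hj
    have h1 : v j * z j + l j * u j = 0 := hgu j
    have h2 : u j * z j + l j * v j = 0 := by have := hgv j; rwa [gAF, hz'] at this
    have h3 : l j ^ 2 < z j ^ 2 := by
      rw [← sq_abs (z j)]
      have := (hBm j).1 hj
      have := hl j
      nlinarith
    constructor
    · have : (z j ^ 2 - l j ^ 2) * u j = 0 := by linear_combination z j * h2 - l j * h1
      rcases mul_eq_zero.1 this with h | h
      · linarith
      · exact h
    · have : (z j ^ 2 - l j ^ 2) * v j = 0 := by linear_combination z j * h1 - l j * h2
      rcases mul_eq_zero.1 this with h | h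
      · linarith
      · exact h
  -- roots
  have hroots : ∀ j, ∃ x x' : ℝ, j ∈ B → (x ≠ x' ∧
      (1 + α * l j) * x ^ 2 = (α * z j) * x + 1 ∧ (1 + α * l j) * x' ^ 2 = (α * z j) * x' + 1 ∧
      (1 + α * l j) ^ 2 * x ^ 2 < 1 ∧ 1 ≤ (1 + α * l j) ^ 2 * x' ^ 2) := by
    intro j
    by_cases hj : j ∈ B
    · obtain ⟨x, x', h⟩ := root_lemma (a := α * z j) (κ := 1 + α * l j)
        (by have := mul_nonneg hα.le (hl j); linarith) (by
          rw [abs_mul, abs_of_pos hα]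
          have := mul_lt_mul_of_pos_left ((hBm j).1 hj) hα
          linarith)
      exact ⟨x, x', fun _ => h⟩
    · exact ⟨0, 0, fun h => absurd h hj⟩
  choose x x' hx using hroots
  obtain ⟨τ, hτ0, hτ1, hτ⟩ := exists_tau B (fun j => ((1 + α * l j) ^ 2 * x j ^ 2) ^ 2)
    (fun j _ => by positivity) (fun j hj => by
      have := (hx j hj).2.2.2.1
      have h0 : 0 ≤ (1 + α * l j) ^ 2 * x j ^ 2 := by positivity
      nlinarith)
  set t : ℝ := (1 - τ) / 2 with ht
  have ht0 : 0 < t := by rw [ht]; linarith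
  set K : ℝ := α * (1 + 1 / t) / 2 with hK
  have hK0 : 0 < K := by positivity
  set pf : (Fin n → ℝ) × (Fin n → ℝ) → ℝ := fun d => ∑ j ∈ B, (x j * d.1 j + d.2 j) ^ 2 with hpf
  set nf : (Fin n → ℝ) × (Fin n → ℝ) → ℝ := fun d => ∑ j ∈ B, (x' j * d.1 j + d.2 j) ^ 2
    + ((∑ j ∈ Bᶜ, (d.1 j ^ 2 + d.2 j ^ 2)) + K * QfF A Bᶜ u v z l d.1 d.2) with hnf
  have qQ := QfF_QN A Bᶜ u v z l (fun j hj => (hSm j).1 hj)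
  have hpQ : QN pf := QN.sum _ fun j _ => QN.sq (by fun_prop)
    (fun a b => by simp; ring) (fun t a => by simp; ring)
  have hnQ : QN nf := by
    refine QN.add (QN.sum _ fun j _ => QN.sq (by fun_prop)
      (fun a b => by simp; ring) (fun t a => by simp; ring)) (QN.add (QN.sum _ fun j _ => ?_)
        (qQ.smul hK0.le))
    exact QN.add (QN.sq (by fun_prop) (fun a b => by simp) (fun t a => by simp))
      (QN.sq (by fun_prop) (fun a b => by simp) (fun t a => by simp))
  -- derivative
  set D := (fderiv ℝ (PhiF A y l α) (u, v)).comp (fderiv ℝ (PsiF A y l α) (u, v)) with hD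
  have hPsi : PsiF A y l α (u, v) = (u, v) := by
    simp [PsiF, hgv]
  have hG : HasStrictFDerivAt (fun p => PhiF A y l α (PsiF A y l α p)) D (u, v) := by
    have h1 : HasStrictFDerivAt (PsiF A y l α) (fderiv ℝ (PsiF A y l α) (u, v)) (u, v) :=
      (PsiF_contDiff A y l α).contDiffAt.hasStrictFDerivAt (by norm_num)
    have h2 : HasStrictFDerivAt (PhiF A y l α) (fderiv ℝ (PhiF A y l α) (u, v))
        (PsiF A y l α (u, v)) := by
      rw [hPsi]
      exact (PhiF_contDiff A y l α).contDiffAt.hasStrictFDerivAt (by norm_num)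
    exact h2.comp (u, v) h1
  have hD2 : ∀ d j, (D d).2 j = d.2 j + α * (d.1 j * z j + u j * zdF A v u d.2 d.1 j
      + l j * d.2 j) := by
    intro d j
    simp [hD, PhiF_fderiv, PsiF_fderiv, hz']
  have hD1 : ∀ d j, (D d).1 j = d.1 j + α * ((D d).2 j * z j
      + v j * zdF A u v d.1 (D d).2 j + l j * d.1 j) := by
    intro d j
    simp [hD, PhiF_fderiv, PsiF_fderiv, hz']
    exact Or.inl (Or.inl rfl)
  have heig : ∀ d, ∀ j ∈ B, ∀ c : ℝ, (1 + α * l j) * c ^ 2 = (α * z j) * c + 1 →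
      c * (D d).1 j + (D d).2 j = (1 + α * l j) ^ 2 * c ^ 2 * (c * d.1 j + d.2 j) := by
    intro d j hj c hc
    obtain ⟨hu0, hv0⟩ := hzero j hj
    refine eig_lemma hc ?_ ?_
    · rw [hD2, hu0]; ring
    · rw [hD1, hv0]; ring
  have hpD : ∀ a, pf (D a) ≤ τ * pf a := by
    intro a
    simp only [hpf]
    rw [Finset.mul_sum]
    refine Finset.sum_le_sum fun j hj => ?_
    rw [heig a j hj _ (hx j hj).2.1, mul_pow]
    exact mul_le_mul_of_nonneg_right (hτ j hj) (sq_nonneg _)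
  have hnD : ∀ a, nf a ≤ (1 + t) * nf (D a) := by
    intro a
    have hb : ∑ j ∈ B, (x' j * a.1 j + a.2 j) ^ 2 ≤
        ∑ j ∈ B, (x' j * (D a).1 j + (D a).2 j) ^ 2 := by
      refine Finset.sum_le_sum fun j hj => ?_
      rw [heig a j hj _ (hx j hj).2.2.1, mul_pow]
      have := (hx j hj).2.2.2.2
      have h2 : 1 ≤ ((1 + α * l j) ^ 2 * x' j ^ 2) ^ 2 := by nlinarith
      have := mul_le_mul_of_nonneg_right h2 (sq_nonneg (x' j * a.1 j + a.2 j))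
      linarith
    have hb0 : 0 ≤ ∑ j ∈ B, (x' j * (D a).1 j + (D a).2 j) ^ 2 :=
      Finset.sum_nonneg fun j _ => sq_nonneg _
    have hu : ∀ j ∉ Bᶜ, u j = 0 := fun j hj => (hzero j (by simpa using hj)).1
    have hv : ∀ j ∉ Bᶜ, v j = 0 := fun j hj => (hzero j (by simpa using hj)).2
    have st1 := QfF_step A Bᶜ u v z l hα (fun j _ => hl j) hv (D a).1 a.1 (D a).2
      (fun j _ => hD1 a j)
    have st2 := QfF_step A Bᶜ v u z l hα (fun j _ => hl j) hu (D a).2 a.2 a.1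
      (fun j _ => hD2 a j)
    rw [QfF_comm A Bᶜ v u z l a.2 a.1, QfF_comm A Bᶜ v u z l (D a).2 a.1] at st2
    have hsum : ∑ j ∈ Bᶜ, (a.1 j ^ 2 + a.2 j ^ 2) ≤
        (1 + t) * ∑ j ∈ Bᶜ, ((D a).1 j ^ 2 + (D a).2 j ^ 2) + (1 + 1 / t) *
        (∑ j ∈ Bᶜ, (a.1 j - (D a).1 j) ^ 2 + ∑ j ∈ Bᶜ, (a.2 j - (D a).2 j) ^ 2) := by
      rw [← Finset.sum_add_distrib, Finset.mul_sum, Finset.mul_sum, ← Finset.sum_add_distrib]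
      refine Finset.sum_le_sum fun j _ => ?_
      have h1 := weak_sq ht0 ((D a).1 j) (a.1 j - (D a).1 j)
      have h2 := weak_sq ht0 ((D a).2 j) (a.2 j - (D a).2 j)
      simp only [add_sub_cancel] at h1 h2
      linarith
    have hQ0 : 0 ≤ QfF A Bᶜ u v z l (D a).1 (D a).2 := qQ.nonneg (D a)
    set s1 := ∑ j ∈ Bᶜ, (a.1 j - (D a).1 j) ^ 2
    set s2 := ∑ j ∈ Bᶜ, (a.2 j - (D a).2 j) ^ 2
    have hKe : K * (2 / α) = 1 + 1 / t := by rw [hK]; field_simp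
    have hQ1 : K * QfF A Bᶜ u v z l a.1 a.2 + (1 + 1 / t) * (s1 + s2) ≤
        K * QfF A Bᶜ u v z l (D a).1 (D a).2 := by
      rw [← hKe]
      have : QfF A Bᶜ u v z l a.1 a.2 + 2 / α * (s1 + s2) ≤
        QfF A Bᶜ u v z l (D a).1 (D a).2 := by linarith
      have := mul_le_mul_of_nonneg_left this hK0.le
      linarith
    have hKQ := mul_nonneg hK0.le hQ0
    simp only [hnf]
    nlinarith
  have h0 : ∀ a, pf a + nf a = 0 → a = 0 := by
    intro a ha
    have p0 := hpQ.nonneg a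
    have n0 := hnQ.nonneg a
    have hp0 : pf a = 0 := by linarith
    have hn0 : nf a = 0 := by linarith
    have c1 : 0 ≤ ∑ j ∈ B, (x' j * a.1 j + a.2 j) ^ 2 :=
      Finset.sum_nonneg fun j _ => sq_nonneg _
    have c2 : 0 ≤ ∑ j ∈ Bᶜ, (a.1 j ^ 2 + a.2 j ^ 2) :=
      Finset.sum_nonneg fun j _ => by positivity
    have c3 : 0 ≤ K * QfF A Bᶜ u v z l a.1 a.2 := mul_nonneg hK0.le (qQ.nonneg a)
    simp only [hnf] at hn0
    have d1 : ∑ j ∈ B, (x' j * a.1 j + a.2 j) ^ 2 = 0 := by linarith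
    have d2 : ∑ j ∈ Bᶜ, (a.1 j ^ 2 + a.2 j ^ 2) = 0 := by linarith
    simp only [hpf] at hp0
    rw [Finset.sum_eq_zero_iff_of_nonneg (fun j _ => sq_nonneg _)] at d1 hp0
    rw [Finset.sum_eq_zero_iff_of_nonneg (fun j _ => by positivity)] at d2
    have hj : ∀ j, a.1 j = 0 ∧ a.2 j = 0 := by
      intro j
      by_cases hj : j ∈ B
      · have e1 := pow_eq_zero_iff (two_ne_zero) |>.1 (d1 j hj)
        have e2 := pow_eq_zero_iff (two_ne_zero) |>.1 (hp0 j hj)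
        have e3 : (x j - x' j) * a.1 j = 0 := by linarith
        have e4 : a.1 j = 0 := (mul_eq_zero.1 e3).resolve_left (sub_ne_zero.2 (hx j hj).1)
        rw [e4] at e1
        exact ⟨e4, by linarith⟩
      · have e := d2 j (by simpa using hj)
        constructor <;> nlinarith [sq_nonneg (a.1 j), sq_nonneg (a.2 j)]
    ext j
    · exact (hj j).1
    · exact (hj j).2
  obtain ⟨U, hUo, hPU, hU⟩ := cone_lemma hG hpQ hnQ h0 hτ0 (by linarith : (1:ℝ) ≤ 1 + t)
    (by rw [ht]; nlinarith) hpD hnD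
  refine ⟨U, hUo, hPU, ?_⟩
  -- direction
  obtain ⟨j0, hj0⟩ := hbad
  have hj0B : j0 ∈ B := (hBm j0).2 hj0
  have hw : nf (Pi.single j0 1, Pi.single j0 (-x' j0)) < pf (Pi.single j0 1, Pi.single j0 (-x' j0)) := by
    have e1 : nf (Pi.single j0 1, Pi.single j0 (-x' j0)) = 0 := by
      obtain ⟨hu0, hv0⟩ := hzero j0 hj0B
      have hne : ∀ j ∈ Bᶜ, j ≠ j0 := fun j hj h => by
        subst h; simp at hj; exact hj hj0B
      simp only [hnf, QfF]
      rw [Finset.sum_eq_zero, Finset.sum_eq_zero, Finset.sum_eq_zero, Finset.sum_eq_zero]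
      · simp
      · intro j hj
        simp [Pi.single_eq_of_ne (hne j hj)]
      · intro i _
        rw [Finset.sum_eq_zero]
        · simp
        · intro k _
          by_cases hk : k = j0
          · subst hk; simp [hu0, hv0]
          · simp [Pi.single_eq_of_ne hk]
      · intro j hj
        simp [Pi.single_eq_of_ne (hne j hj)]
      · intro j hj
        by_cases hk : j = j0
        · subst hk; simp
        · simp [Pi.single_eq_of_ne hk]
    rw [e1]
    simp only [hpf]
    refine Finset.sum_pos' (fun j _ => sq_nonneg _) ⟨j0, hj0B, ?_⟩
    have := sub_ne_zero.2 (hx j0 hj0B).1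
    simp only [Pi.single_eq_same, mul_one, ← sub_eq_add_neg]
    positivity
  have hHaar : (MeasureTheory.volume :
      MeasureTheory.Measure ((Fin n → ℝ) × (Fin n → ℝ))).IsAddHaarMeasure :=
    MeasureTheory.Measure.prod.instIsAddHaarMeasure _ _
  refine null_of_cone MeasureTheory.volume hpQ hnQ hw ?_
  rintro a ⟨s, rfl, hs, hGs⟩ b ⟨r, rfl, hr, hGr⟩ hab
  exact hU s r hs hr hGs hGr hab
end Loc

section Fin
variable {m n : ℕ}

def lF (T : Finset (Fin n)) (lam : ℝ) (j : Fin n) : ℝ := if j ∈ T then 0 else lam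

theorem hpp_eq (A : Matrix (Fin m) (Fin n) ℝ) (y : Fin m → ℝ)
    (T : Finset (Fin n)) (lam : ℝ) (u v : Fin n → ℝ) :
    hppObj A y T lam (u, v) = (∑ i, ((∑ k, A i k * (u k * v k)) - y i) ^ 2) / 2
      + (∑ j, lF T lam j * (u j ^ 2 + v j ^ 2)) / 2 := by
  have : ∑ j, lF T lam j * (u j ^ 2 + v j ^ 2) = ∑ j ∈ Tᶜ, lam * (u j ^ 2 + v j ^ 2) := by
    rw [← Finset.sum_subset (Finset.subset_univ Tᶜ)]
    · refine Finset.sum_congr rfl fun j hj => ?_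
      have : j ∉ T := by simpa using hj
      simp [lF, this]
    · intro j _ hj
      have : j ∈ T := by simpa using hj
      simp [lF, this]
  rw [this, ← Finset.mul_sum, Finset.sum_add_distrib]
  simp only [hppObj, Matrix.mulVec, dotProduct]
  ring

theorem hpp_comm (A : Matrix (Fin m) (Fin n) ℝ) (y : Fin m → ℝ)
    (T : Finset (Fin n)) (lam : ℝ) (u v : Fin n → ℝ) :
    hppObj A y T lam (u, v) = hppObj A y T lam (v, u) := by
  rw [hpp_eq, hpp_eq]
  simp only [mul_comm (u _) (v _), add_comm (u _ ^ 2) (v _ ^ 2)]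

theorem lin_zero {a b : ℝ} (h : ∀ t : ℝ, 0 ≤ a * t ^ 2 + b * t) : b = 0 := by
  have hs : 0 < |a| + 1 := by positivity
  have h1 := h (-b / (|a| + 1))
  have h2 : a * (-b / (|a| + 1)) ^ 2 + b * (-b / (|a| + 1))
      = b ^ 2 * (a - |a| - 1) / (|a| + 1) ^ 2 := by field_simp; ring
  rw [h2] at h1
  have h3 : 0 ≤ b ^ 2 * (a - |a| - 1) := by
    by_contra hc
    push Not at hc
    have := div_neg_of_neg_of_pos hc (by positivity : 0 < (|a| + 1) ^ 2)
    linarith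
  have h4 := le_abs_self a
  have : b ^ 2 ≤ 0 := by nlinarith [sq_nonneg b]
  exact pow_eq_zero_iff two_ne_zero |>.1 (le_antisymm this (sq_nonneg b))

theorem stat_lemma (A : Matrix (Fin m) (Fin n) ℝ) (y : Fin m → ℝ)
    (T : Finset (Fin n)) (lam : ℝ) {α : ℝ} (hα : 0 < α) (u u1 v : Fin n → ℝ)
    (h : ∀ u' : Fin n → ℝ, hppObj A y T lam (u1, v) + (∑ i, (u1 i - u i) ^ 2) / (2 * α)
              ≤ hppObj A y T lam (u', v) + (∑ i, (u' i - u i) ^ 2) / (2 * α)) (j : Fin n) :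
    u1 j + α * gAF A y (lF T lam) u1 v j = u j := by
  set l := lF T lam with hl
  set R : Fin m → ℝ := fun i => (∑ k, A i k * (u1 k * v k)) - y i with hR
  have hz : zzF A y u1 v j = ∑ i, A i j * R i := rfl
  have key : ∀ t : ℝ, 0 ≤ ((∑ i, (A i j * v j) ^ 2) / 2 + l j / 2 + 1 / (2 * α)) * t ^ 2
      + (v j * zzF A y u1 v j + l j * u1 j + (u1 j - u j) / α) * t := by
    intro t
    have h1 := h (fun k => u1 k + if k = j then t else 0)
    rw [hpp_eq, hpp_eq] at h1
    have e1 : ∀ i, ∑ k, A i k * ((u1 k + if k = j then t else 0) * v k) - y i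
        = R i + t * (A i j * v j) := by
      intro i
      have : ∀ k, A i k * ((u1 k + if k = j then t else 0) * v k) = A i k * (u1 k * v k)
          + if k = j then t * (A i k * v k) else 0 := by
        intro k; split_ifs <;> ring
      simp only [this, Finset.sum_add_distrib, Finset.sum_ite_eq', Finset.mem_univ, if_true, hR]
      ring
    have e2 : ∑ k, l k * ((u1 k + if k = j then t else 0) ^ 2 + v k ^ 2)
        = ∑ k, l k * (u1 k ^ 2 + v k ^ 2) + l j * (2 * t * u1 j + t ^ 2) := by
      have : ∀ k, l k * ((u1 k + if k = j then t else 0) ^ 2 + v k ^ 2)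
          = l k * (u1 k ^ 2 + v k ^ 2) + if k = j then l k * (2 * t * u1 k + t ^ 2) else 0 := by
        intro k; split_ifs <;> ring
      simp only [this, Finset.sum_add_distrib, Finset.sum_ite_eq', Finset.mem_univ, if_true]
    have e3 : ∑ k, ((u1 k + if k = j then t else 0) - u k) ^ 2
        = ∑ k, (u1 k - u k) ^ 2 + (2 * t * (u1 j - u j) + t ^ 2) := by
      have : ∀ k, ((u1 k + if k = j then t else 0) - u k) ^ 2
          = (u1 k - u k) ^ 2 + if k = j then (2 * t * (u1 k - u k) + t ^ 2) else 0 := by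
        intro k; split_ifs <;> ring
      simp only [this, Finset.sum_add_distrib, Finset.sum_ite_eq', Finset.mem_univ, if_true]
    have e4 : ∑ i, (R i + t * (A i j * v j)) ^ 2 = ∑ i, R i ^ 2
        + 2 * t * (v j * zzF A y u1 v j) + t ^ 2 * ∑ i, (A i j * v j) ^ 2 := by
      rw [hz, Finset.mul_sum, Finset.mul_sum, Finset.mul_sum, ← Finset.sum_add_distrib,
        ← Finset.sum_add_distrib]
      exact Finset.sum_congr rfl fun i _ => by ring
    simp only [e1, e4, ← hl, e2, e3] at h1
    have e5 : ∀ X : ℝ, (X + (2 * t * (u1 j - u j) + t ^ 2)) / (2 * α) = X / (2 * α)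
        + (u1 j - u j) / α * t + 1 / (2 * α) * t ^ 2 := by
      intro X; field_simp; ring
    rw [e5] at h1
    change (∑ i, R i ^ 2) / 2 + _ + _ ≤ _ at h1
    linarith
  have h0 := lin_zero key
  unfold gAF
  field_simp at h0
  linarith

theorem glob_min (A : Matrix (Fin m) (Fin n) ℝ) (y : Fin m → ℝ)
    (T : Finset (Fin n)) (lam : ℝ) (u v : Fin n → ℝ)
    (hgu : ∀ j, gAF A y (lF T lam) u v j = 0) (hgv : ∀ j, gAF A y (lF T lam) v u j = 0)
    (hz : ∀ j, |zzF A y u v j| ≤ lF T lam j) (q : (Fin n → ℝ) × (Fin n → ℝ)) :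
    hppObj A y T lam (u, v) ≤ hppObj A y T lam q := by
  obtain ⟨a, b⟩ := q
  rw [hpp_eq, hpp_eq]
  set l := lF T lam with hl
  set R : Fin m → ℝ := fun i => (∑ k, A i k * (u k * v k)) - y i with hR
  have hzR : ∀ j, zzF A y u v j = ∑ i, A i j * R i := fun j => rfl
  set R' : Fin m → ℝ := fun i => (∑ k, A i k * (a k * b k)) - y i with hR'
  have h1 : ∑ i, R i * (R' i - R i) = ∑ j, zzF A y u v j * (a j * b j - u j * v j) := by
    have : ∀ i, R' i - R i = ∑ k, A i k * (a k * b k - u k * v k) := by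
      intro i
      simp only [hR, hR', mul_sub, Finset.sum_sub_distrib]
      ring
    simp only [this, hzR, Finset.mul_sum, Finset.sum_mul]
    rw [Finset.sum_comm]
    exact Finset.sum_congr rfl fun j _ => Finset.sum_congr rfl fun i _ => by ring
  have h2 : ∑ i, R i ^ 2 + 2 * ∑ i, R i * (R' i - R i) ≤ ∑ i, R' i ^ 2 := by
    rw [Finset.mul_sum, ← Finset.sum_add_distrib]
    exact Finset.sum_le_sum fun i _ => by nlinarith [sq_nonneg (R' i - R i)]
  have h3 : ∑ j, l j * (u j ^ 2 + v j ^ 2) ≤ ∑ j, l j * (a j ^ 2 + b j ^ 2)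
      + 2 * ∑ j, zzF A y u v j * (a j * b j - u j * v j) := by
    rw [Finset.mul_sum, ← Finset.sum_add_distrib]
    refine Finset.sum_le_sum fun j _ => ?_
    have g1 : v j * zzF A y u v j + l j * u j = 0 := hgu j
    have g2 : u j * zzF A y u v j + l j * v j = 0 := by
      rw [zzF_comm]; exact hgv j
    obtain ⟨z1, z2⟩ := abs_le.1 (hz j)
    have k1 := mul_nonneg (by linarith : 0 ≤ l j + zzF A y u v j) (sq_nonneg (a j + b j))
    have k2 := mul_nonneg (by linarith : 0 ≤ l j - zzF A y u v j) (sq_nonneg (a j - b j))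
    have e : l j * (u j ^ 2 + v j ^ 2) + 2 * (zzF A y u v j * (u j * v j)) = 0 := by
      linear_combination u j * g1 + v j * g2
    nlinarith
  change (∑ i, R i ^ 2) / 2 + _ ≤ (∑ i, R' i ^ 2) / 2 + _
  rw [h1] at h2
  linarith

end Fin

theorem stmt18 {m n : ℕ} (A : Matrix (Fin m) (Fin n) ℝ) (hrank : A.rank = m)
    (y : Fin m → ℝ) (T : Finset (Fin n)) (hT : T.card ≤ m)
    (lam α : ℝ) (hlam : 0 < lam) (hα : 0 < α) :
    MeasureTheory.volume
      {p₀ : (Fin n → ℝ) × (Fin n → ℝ) |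
        -- the step parameter exceeds the bi-smoothness constant on the level set of `p₀`
        sSup {M : ℝ | ∃ q : (Fin n → ℝ) × (Fin n → ℝ),
            hppObj A y T lam q ≤ hppObj A y T lam p₀ ∧
            M = max (hessuNorm A y T lam q) (hessvNorm A y T lam q)} < α ∧
        -- the proximal alternating minimization sequence started at `p₀` converges to a
        -- critical point of `g` that is not a global minimizer
        ∃ u v : ℕ → (Fin n → ℝ), u 0 = p₀.1 ∧ v 0 = p₀.2 ∧
          (∀ k : ℕ, ∀ u' : Fin n → ℝ,
            hppObj A y T lam (u (k + 1), v k) + (∑ i, (u (k + 1) i - u k i) ^ 2) / (2 * α)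
              ≤ hppObj A y T lam (u', v k) + (∑ i, (u' i - u k i) ^ 2) / (2 * α)) ∧
          (∀ k : ℕ, ∀ v' : Fin n → ℝ,
            hppObj A y T lam (u (k + 1), v (k + 1)) + (∑ i, (v (k + 1) i - v k i) ^ 2) / (2 * α)
              ≤ hppObj A y T lam (u (k + 1), v') + (∑ i, (v' i - v k i) ^ 2) / (2 * α)) ∧
          ∃ pstar : (Fin n → ℝ) × (Fin n → ℝ),
            Filter.Tendsto (fun k => (u k, v k)) Filter.atTop (nhds pstar) ∧
            fderiv ℝ (hppObj A y T lam) pstar = 0 ∧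
            ¬ ∀ q : (Fin n → ℝ) × (Fin n → ℝ),
                hppObj A y T lam pstar ≤ hppObj A y T lam q} = 0 := by
  have hHaar : (MeasureTheory.volume :
      MeasureTheory.Measure ((Fin n → ℝ) × (Fin n → ℝ))).IsAddHaarMeasure :=
    MeasureTheory.Measure.prod.instIsAddHaarMeasure _ _
  have hl : ∀ j, 0 ≤ lF T lam j := by
    intro j; unfold lF; split_ifs <;> linarith
  have hdPhi := (PhiF_contDiff A y (lF T lam) α)
  have hdPsi := (PsiF_contDiff A y (lF T lam) α)
  have hGd : ContDiff ℝ 1 (fun p => PhiF A y (lF T lam) α (PsiF A y (lF T lam) α p)) :=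
    hdPhi.comp hdPsi
  have main := null_cover (MeasureTheory.volume :
      MeasureTheory.Measure ((Fin n → ℝ) × (Fin n → ℝ)))
    (G := fun p => PhiF A y (lF T lam) α (PsiF A y (lF T lam) α p))
    (hGd.differentiable (by norm_num))
    (B := {P | (∀ j, gAF A y (lF T lam) P.1 P.2 j = 0) ∧ (∀ j, gAF A y (lF T lam) P.2 P.1 j = 0) ∧
      ∃ j, lF T lam j < |zzF A y P.1 P.2 j|})
    (fun P hP => local_null A y (lF T lam) hl hα P hP.1 hP.2.1 hP.2.2)
  refine MeasureTheory.measure_mono_null ?_ main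
  rintro p₀ ⟨-, u, v, hu0, hv0, hu, hv, P, hlim, -, hnot⟩
  have hstep : ∀ k, PhiF A y (lF T lam) α (PsiF A y (lF T lam) α (u (k+1), v (k+1)))
      = (u k, v k) := by
    intro k
    have e1 : PsiF A y (lF T lam) α (u (k+1), v (k+1)) = (u (k+1), v k) := by
      refine Prod.ext rfl (funext fun j => ?_)
      refine stat_lemma A y T lam hα (v k) (v (k+1)) (u (k+1)) ?_ j
      intro v'
      rw [hpp_comm A y T lam (v (k+1)), hpp_comm A y T lam v']
      exact hv k v'
    rw [e1]
    exact Prod.ext (funext fun j => stat_lemma A y T lam hα (u k) (u (k+1)) (v k) (hu k) j) rfl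
  have hfix : PhiF A y (lF T lam) α (PsiF A y (lF T lam) α P) = P := by
    have h1 := (hGd.continuous.tendsto P).comp (hlim.comp (Filter.tendsto_add_atTop_nat 1))
    refine tendsto_nhds_unique h1 (hlim.congr fun k => ?_)
    exact (hstep k).symm
  have hgv : ∀ j, gAF A y (lF T lam) P.2 P.1 j = 0 := by
    intro j
    have := congrFun (congrArg Prod.snd hfix) j
    simp only [PhiF, PsiF] at this
    have h2 : α * gAF A y (lF T lam) P.2 P.1 j = 0 := by linarith
    exact (mul_eq_zero.1 h2).resolve_left hα.ne'
  have hPsi : PsiF A y (lF T lam) α P = P := by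
    refine Prod.ext rfl (funext fun j => ?_)
    simp [PsiF, hgv]
  have hgu : ∀ j, gAF A y (lF T lam) P.1 P.2 j = 0 := by
    intro j
    rw [hPsi] at hfix
    have := congrFun (congrArg Prod.fst hfix) j
    simp only [PhiF] at this
    have h2 : α * gAF A y (lF T lam) P.1 P.2 j = 0 := by linarith
    exact (mul_eq_zero.1 h2).resolve_left hα.ne'
  refine ⟨fun k => (u k, v k), ?_, hstep, P, ⟨hgu, hgv, ?_⟩, hlim⟩
  · exact Prod.ext hu0 hv0
  · by_contra hc
    push Not at hc
    exact hnot (glob_min A y T lam P.1 P.2 hgu hgv hc)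
end
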